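/- arXiv:2409.20216 — 8 statements merged into one kernel-verified Lean document; each statement's English description precedes it below -/
import Mathlib

section
/- Let 0 < λ ≤ π/2. Then the function r ↦ 1 + r² − 2λr³ − e^{λr}(1 − λr + r² + λr³) has exactly one root in the open interval (0,1). -/
open Set in
/-- A function with value `0` at `0` and positive derivative on `(0, ∞)` is positive there. -/
lemma pos_of_hasDerivAt_pos {f f' : ℝ → ℝ} (hf : ∀ x, HasDerivAt f (f' x) x) (h0 : f 0 = 0)
    (hf' : ∀ x, 0 < x → 0 < f' x) {x : ℝ} (hx : 0 < x) : 0 < f x := by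
  have hmono : StrictMonoOn f (Ici 0) := by
    refine strictMonoOn_of_deriv_pos (convex_Ici 0)
      (fun y _ => (hf y).continuousAt.continuousWithinAt) fun y hy => ?_
    rw [interior_Ici] at hy
    rw [(hf y).deriv]
    exact hf' y hy
  simpa [h0] using hmono self_mem_Ici hx.le hx

/-- Functions `e^{2x} q(x) + e^x p(x) + m x + n` with `q` quadratic and `p` cubic
are closed under differentiation. -/
lemma hasDerivAt_exp_quadratic_add_exp_cubic (a b c d k l m n u x : ℝ) :
    HasDerivAt (fun x : ℝ => Real.exp x ^ 2 * (a * x ^ 2 + b * x + c)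
        + Real.exp x * (d * x ^ 3 + k * x ^ 2 + l * x + m) + n * x + u)
      (Real.exp x ^ 2 * (2 * a * x ^ 2 + (2 * b + 2 * a) * x + (2 * c + b))
        + Real.exp x * (d * x ^ 3 + (k + 3 * d) * x ^ 2 + (l + 2 * k) * x + (m + l)) + n) x := by
  have hE := Real.hasDerivAt_exp x
  have hx := hasDerivAt_id' x
  have h := ((((hE.fun_pow 2).fun_mul
    ((((hx.fun_pow 2).const_mul a).fun_add (hx.const_mul b)).add_const c)).fun_add
    (hE.fun_mul (((((hx.fun_pow 3).const_mul d).fun_add ((hx.fun_pow 2).const_mul k)).fun_add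
      (hx.const_mul l)).add_const m))).fun_add (hx.const_mul n)).add_const u
  refine h.congr_deriv ?_
  push_cast
  ring

/-- Up to a factor positive for `x > 0`, this is the derivative of
`x² (e^x (1 + x) + 2x - 1) / (1 + (x - 1) e^x)`. -/
lemma exp_quadratic_add_exp_cubic_pos {x : ℝ} (hx : 0 < x) :
    0 < Real.exp x ^ 2 * (x ^ 2 - x - 1)
      + Real.exp x * (-x ^ 3 + 4 * x ^ 2 - 2 * x + 2) + 3 * x - 1 := by
  have h₄ : ∀ x : ℝ, 0 < x → 0 < Real.exp x ^ 2 * (16 * x ^ 2 + 48 * x + 0)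
      + Real.exp x * (-1 * x ^ 3 + (-8) * x ^ 2 + (-6) * x + 18) := by
    intro x hx
    have hE := Real.add_one_le_exp x
    have hfac : 0 < Real.exp x * (16 * x ^ 2 + 48 * x)
        + (-1 * x ^ 3 + (-8) * x ^ 2 + (-6) * x + 18) := by
      have := mul_le_mul_of_nonneg_right hE (by positivity : 0 ≤ 16 * x ^ 2 + 48 * x)
      have : 0 < 15 * x ^ 3 + 56 * x ^ 2 + 42 * x + 18 := by positivity
      linarith
    linarith [mul_pos (Real.exp_pos x) hfac]
  have h₃ : ∀ x : ℝ, 0 < x → 0 < Real.exp x ^ 2 * (8 * x ^ 2 + 16 * x + (-8))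
      + Real.exp x * (-1 * x ^ 3 + (-5) * x ^ 2 + 4 * x + 14) + 0 * x + (-6) :=
    fun x hx => pos_of_hasDerivAt_pos
      (fun x => (hasDerivAt_exp_quadratic_add_exp_cubic 8 16 (-8) (-1) (-5) 4 14 0 (-6) x))
      (by norm_num) (fun x hx => by linarith [h₄ x hx]) hx
  have h₂ : ∀ x : ℝ, 0 < x → 0 < Real.exp x ^ 2 * (4 * x ^ 2 + 4 * x + (-6))
      + Real.exp x * (-1 * x ^ 3 + (-2) * x ^ 2 + 8 * x + 6) + 0 * x + 0 :=
    fun x hx => pos_of_hasDerivAt_pos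
      (fun x => (hasDerivAt_exp_quadratic_add_exp_cubic 4 4 (-6) (-1) (-2) 8 6 0 0 x))
      (by norm_num) (fun x hx => by linarith [h₃ x hx]) hx
  have h₁ : ∀ x : ℝ, 0 < x → 0 < Real.exp x ^ 2 * (2 * x ^ 2 + 0 * x + (-3))
      + Real.exp x * (-1 * x ^ 3 + 1 * x ^ 2 + 6 * x + 0) + 0 * x + 3 :=
    fun x hx => pos_of_hasDerivAt_pos
      (fun x => (hasDerivAt_exp_quadratic_add_exp_cubic 2 0 (-3) (-1) 1 6 0 0 3 x))
      (by norm_num) (fun x hx => by linarith [h₂ x hx]) hx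
  have h₀ := pos_of_hasDerivAt_pos
    (fun x => (hasDerivAt_exp_quadratic_add_exp_cubic 1 (-1) (-1) (-1) 4 (-2) 2 3 (-1) x))
    (by norm_num) (fun x hx => by linarith [h₁ x hx]) hx
  linarith

lemma sq_half_lt_one_add_sub_one_mul_exp {x : ℝ} (hx : 0 < x) :
    x ^ 2 / 2 < 1 + (x - 1) * Real.exp x := by
  have h := pos_of_hasDerivAt_pos (f := fun x => 1 + (x - 1) * Real.exp x - x ^ 2 / 2)
    (f' := fun x => x * (Real.exp x - 1)) (fun x => by
      have h := ((((hasDerivAt_id' x).sub_const 1).fun_mul (Real.hasDerivAt_exp x)).const_add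
        1).fun_sub (((hasDerivAt_id' x).fun_pow 2).div_const 2)
      refine h.congr_deriv ?_
      push_cast
      ring) (by simp) (fun x hx => mul_pos hx (by linarith [Real.add_one_lt_exp hx.ne'])) hx
  simpa using h

open Set in
lemma strictMonoOn_sq_mul_div_one_add_sub_one_mul_exp :
    StrictMonoOn (fun x : ℝ => x ^ 2 * (Real.exp x * (1 + x) + 2 * x - 1)
      / (1 + (x - 1) * Real.exp x)) (Ioi 0) := by
  have hpos : ∀ x : ℝ, 0 < x → 0 < 1 + (x - 1) * Real.exp x := fun x hx =>
    lt_trans (by positivity) (sq_half_lt_one_add_sub_one_mul_exp hx)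
  have hderiv : ∀ x : ℝ, 0 < x → HasDerivAt
      (fun x : ℝ => x ^ 2 * (Real.exp x * (1 + x) + 2 * x - 1) / (1 + (x - 1) * Real.exp x))
      (2 * x * (Real.exp x ^ 2 * (x ^ 2 - x - 1)
        + Real.exp x * (-x ^ 3 + 4 * x ^ 2 - 2 * x + 2) + 3 * x - 1)
        / (1 + (x - 1) * Real.exp x) ^ 2) x := by
    intro x hx
    have hE := Real.hasDerivAt_exp x
    have hid := hasDerivAt_id' x
    have h := ((hid.fun_pow 2).fun_mul (((hE.fun_mul (hid.const_add 1)).fun_add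
      (hid.const_mul 2)).sub_const 1)).fun_div
      (((hid.sub_const 1).fun_mul hE).const_add 1) (hpos x hx).ne'
    refine h.congr_deriv ?_
    congr 1
    push_cast
    ring
  refine strictMonoOn_of_deriv_pos (convex_Ioi 0)
    (fun x hx => (hderiv x hx).continuousAt.continuousWithinAt) fun x hx => ?_
  rw [interior_Ioi] at hx
  rw [(hderiv x hx).deriv]
  have hx' : 0 < x := hx
  exact div_pos (mul_pos (by positivity) (exp_quadratic_add_exp_cubic_pos hx'))
    (pow_pos (hpos x hx') 2)

/-- For 0 < λ ≤ π/2, the function r ↦ 1 + r² − 2λr³ − e^{λr}(1 − λr + r² + λr³)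
has exactly one root in (0,1). -/
theorem unique_root_Sstar_lambda_e (lam : ℝ) (hlam₀ : 0 < lam) (hlam₁ : lam ≤ Real.pi / 2) :
    ∃! r : ℝ, r ∈ Set.Ioo (0:ℝ) 1 ∧
      1 + r^2 - 2*lam*r^3 - Real.exp (lam*r) * (1 - lam*r + r^2 + lam*r^3) = 0 := by
  refine existsUnique_of_exists_of_unique ?_ ?_
  · have hsmall : ∀ᶠ r in nhdsWithin (0 : ℝ) (Set.Ioi 0),
        Real.exp (lam * r) * (1 + lam * r) + 2 * (lam * r) - 1 < lam ^ 2 / 2 := by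
      have hcont : Continuous fun r : ℝ =>
          Real.exp (lam * r) * (1 + lam * r) + 2 * (lam * r) - 1 := by fun_prop
      exact nhdsWithin_le_nhds
        (hcont.continuousAt.eventually_lt_const (by simpa using by positivity))
    obtain ⟨s, hs, hs₀, hs₁⟩ :=
      (hsmall.and (Ioo_mem_nhdsGT (zero_lt_one (α := ℝ)))).exists
    have hcont : Continuous fun r : ℝ =>
        1 + r^2 - 2*lam*r^3 - Real.exp (lam*r) * (1 - lam*r + r^2 + lam*r^3) := by fun_prop
    have hpos : 0 < 1 + s^2 - 2*lam*s^3
        - Real.exp (lam*s) * (1 - lam*s + s^2 + lam*s^3) := by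
      have h := sq_half_lt_one_add_sub_one_mul_exp (mul_pos hlam₀ hs₀)
      have h' := mul_lt_mul_of_pos_left hs (pow_pos hs₀ 2)
      linarith
    have hneg : 1 + (1 : ℝ)^2 - 2*lam*1^3
        - Real.exp (lam*1) * (1 - lam*1 + 1^2 + lam*1^3) < 0 := by
      have h := Real.add_one_lt_exp hlam₀.ne'
      norm_num
      linarith
    obtain ⟨r, hr, hr'⟩ := intermediate_value_Ioo' hs₁.le hcont.continuousOn ⟨hneg, hpos⟩
    exact ⟨r, ⟨hs₀.trans hr.1, hr.2⟩, hr'⟩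
  · have hroot : ∀ r : ℝ, 0 < r →
        1 + r^2 - 2*lam*r^3 - Real.exp (lam*r) * (1 - lam*r + r^2 + lam*r^3) = 0 →
        (lam * r) ^ 2 * (Real.exp (lam * r) * (1 + lam * r) + 2 * (lam * r) - 1)
          / (1 + (lam * r - 1) * Real.exp (lam * r)) = lam ^ 2 := by
      intro r hr h
      have hpos : 0 < 1 + (lam * r - 1) * Real.exp (lam * r) :=
        lt_trans (by positivity) (sq_half_lt_one_add_sub_one_mul_exp (mul_pos hlam₀ hr))
      rw [div_eq_iff hpos.ne']
      linear_combination (-lam ^ 2) * h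
    rintro r s ⟨⟨hr, -⟩, hr'⟩ ⟨⟨hs, -⟩, hs'⟩
    exact mul_left_cancel₀ hlam₀.ne' <|
      strictMonoOn_sq_mul_div_one_add_sub_one_mul_exp.injOn (mul_pos hlam₀ hr) (mul_pos hlam₀ hs)
        ((hroot r hr hr').trans (hroot s hs hs').symm)
end

section
/- Let 0 < λ ≤ π/2 and let f ∈ S*_{λe}. Then the pre-Schwarzian norm of f satisfies ||P_f|| ≤ (1 − α²)(e^{λα} + λα − 1)/α, where α is the unique root in (0,1) of the equation 1 + r² − 2λr³ − e^{λr}(1 − λr + r² + λr³) = 0. -/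
open Metric Set

noncomputable section

/-- The open unit disk in the complex plane. -/
def unitDisk : Set ℂ := Metric.ball 0 1

/-- A function is normalized if it is analytic on the unit disk with f(0)=0 and f'(0)=1. -/
def IsNormalized (f : ℂ → ℂ) : Prop :=
  AnalyticOnNhd ℂ f unitDisk ∧ f 0 = 0 ∧ deriv f 0 = 1

/-- Subordination: f ≺ g on the unit disk. -/
def Subord (f g : ℂ → ℂ) : Prop :=
  ∃ ω : ℂ → ℂ, AnalyticOnNhd ℂ ω unitDisk ∧ ω 0 = 0 ∧
    Set.MapsTo ω unitDisk unitDisk ∧ Set.EqOn f (g ∘ ω) unitDisk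

/-- The quantity z f'(z)/f(z), extended by its analytic value 1 at z = 0. -/
def sratio (f : ℂ → ℂ) (z : ℂ) : ℂ := if z = 0 then 1 else z * deriv f z / f z

/-- The Ma-Minda starlike class S*(φ). -/
def MemSstar (φ f : ℂ → ℂ) : Prop :=
  IsNormalized f ∧ (∀ z ∈ unitDisk, z ≠ 0 → f z ≠ 0) ∧ Subord (sratio f) φ

/-- The Ma-Minda convex class C(φ). -/
def MemC (φ g : ℂ → ℂ) : Prop :=
  IsNormalized g ∧ (∀ z ∈ unitDisk, deriv g z ≠ 0) ∧
    Subord (fun z => 1 + z * deriv (deriv g) z / deriv g z) φ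

/-- The set of values (1-|z|²)|P_f(z)|, z ∈ 𝔻, whose supremum is the pre-Schwarzian norm. -/
def pSVals (f : ℂ → ℂ) : Set ℝ :=
  {x : ℝ | ∃ z ∈ unitDisk, x = (1 - ‖z‖^2) * ‖deriv (deriv f) z / deriv f z‖}

/-- The disk automorphism `w ↦ (w - b) / (1 - conj b * w)`. -/
def diskMobius (b w : ℂ) : ℂ := (w - b) / (1 - (starRingEnd ℂ) b * w)

lemma one_sub_conj_mul_ne_zero {b w : ℂ} (hb : ‖b‖ < 1) (hw : ‖w‖ < 1) :
    1 - (starRingEnd ℂ) b * w ≠ 0 := by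
  intro h
  have h1 : ‖(starRingEnd ℂ) b * w‖ = 1 := by
    rw [← sub_eq_zero.mp h, norm_one]
  rw [norm_mul, RCLike.norm_conj] at h1
  nlinarith [norm_nonneg b, norm_nonneg w]

lemma norm_diskMobius_lt_one {b w : ℂ} (hb : ‖b‖ < 1) (hw : ‖w‖ < 1) :
    ‖diskMobius b w‖ < 1 := by
  have hne := one_sub_conj_mul_ne_zero hb hw
  rw [diskMobius, norm_div, div_lt_one (norm_pos_iff.mpr hne)]
  refine lt_of_pow_lt_pow_left₀ 2 (norm_nonneg _) ?_
  have hb2 : ‖b‖ ^ 2 < 1 := by nlinarith [norm_nonneg b]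
  have hw2 : ‖w‖ ^ 2 < 1 := by nlinarith [norm_nonneg w]
  rw [Complex.sq_norm, Complex.normSq_apply] at *
  rw [Complex.sq_norm, Complex.normSq_apply] at *
  simp only [Complex.sub_re, Complex.sub_im, Complex.mul_re, Complex.mul_im, Complex.conj_re,
    Complex.conj_im, Complex.one_re, Complex.one_im]
  nlinarith [mul_pos (sub_pos.mpr hb2) (sub_pos.mpr hw2)]

lemma hasDerivAt_diskMobius {b w : ℂ} (hb : ‖b‖ < 1) (hw : ‖w‖ < 1) :
    HasDerivAt (diskMobius b)
      ((1 - (starRingEnd ℂ) b * b) / (1 - (starRingEnd ℂ) b * w) ^ 2) w := by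
  have hne := one_sub_conj_mul_ne_zero hb hw
  have h := ((hasDerivAt_id w).sub_const b).div
    (((hasDerivAt_id w).const_mul ((starRingEnd ℂ) b)).const_sub 1) hne
  refine h.congr_deriv ?_
  simp only [id]
  congr 1
  ring

/-- The infinitesimal **Schwarz–Pick lemma**. -/
lemma schwarzPick_norm_deriv_le {ω : ℂ → ℂ} (hd : DifferentiableOn ℂ ω (ball 0 1))
    (hmaps : MapsTo ω (ball 0 1) (ball 0 1)) {z : ℂ} (hz : ‖z‖ < 1) :
    (1 - ‖z‖ ^ 2) * ‖deriv ω z‖ ≤ 1 - ‖ω z‖ ^ 2 := by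
  have hωz : ‖ω z‖ < 1 := by simpa using hmaps (by simpa using hz : z ∈ ball (0 : ℂ) 1)
  have hz' : ‖-z‖ < 1 := by simpa using hz
  have hM0 : diskMobius (-z) 0 = z := by simp [diskMobius]
  have hMmaps : ∀ w : ℂ, ‖w‖ < 1 → diskMobius (-z) w ∈ ball (0 : ℂ) 1 := fun w hw => by
    simpa using norm_diskMobius_lt_one hz' hw
  have hωd : ∀ w ∈ ball (0 : ℂ) 1, HasDerivAt ω (deriv ω w) w := fun w hw =>
    (hd.differentiableAt (isOpen_ball.mem_nhds hw)).hasDerivAt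
  have hder : ∀ w : ℂ, ‖w‖ < 1 → HasDerivAt (fun w => diskMobius (ω z) (ω (diskMobius (-z) w)))
      (_ * (deriv ω (diskMobius (-z) w) * _)) w := fun w hw =>
    (hasDerivAt_diskMobius hωz (by simpa using hmaps (hMmaps w hw))).comp w
      ((hωd _ (hMmaps w hw)).comp w (hasDerivAt_diskMobius hz' hw))
  have key := Complex.norm_deriv_le_one_of_mapsTo_ball (c := 0) (R := 1)
    (f := fun w => diskMobius (ω z) (ω (diskMobius (-z) w)))
    (fun w hw => (hder w (by simpa using hw)).differentiableAt.differentiableWithinAt)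
    (fun w hw => by
      have h0 : diskMobius (ω z) (ω (diskMobius (-z) 0)) = 0 := by
        rw [hM0]; simp [diskMobius]
      simp only [h0]
      simpa using (norm_diskMobius_lt_one hωz (w := ω (diskMobius (-z) w)) (by
        simpa using hmaps (hMmaps w (by simpa using hw)))).le) one_pos
  rw [(hder 0 (by simp)).deriv, hM0] at key
  have e1 : ∀ w : ℂ, (1 - (starRingEnd ℂ) w * w) = ((1 - ‖w‖ ^ 2 : ℝ) : ℂ) := fun w => by
    rw [mul_comm, Complex.mul_conj, Complex.normSq_eq_norm_sq]; push_cast; ring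
  have hp : ∀ w : ℂ, ‖w‖ < 1 → 0 < 1 - ‖w‖ ^ 2 := fun w hw => by
    nlinarith [norm_nonneg w]
  have h1 := hp _ hωz
  have h2 := hp _ hz
  rw [e1, e1] at key
  simp only [norm_mul, norm_div, norm_pow, Complex.norm_real, Real.norm_eq_abs, norm_neg,
    abs_of_pos h1, abs_of_pos h2, mul_zero, sub_zero, one_pow, div_one] at key
  have e2 : (1 - ‖ω z‖ ^ 2) / (1 - ‖ω z‖ ^ 2) ^ 2 = (1 - ‖ω z‖ ^ 2)⁻¹ := by
    field_simp
  rw [e2, inv_mul_le_iff₀ h1] at key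
  linarith

lemma exp_mul_cubic_taylor_le {x : ℝ} (hx : 0 ≤ x) :
    Real.exp x * (2 - 2 * x + x ^ 2 - x ^ 3 / 3) ≤ 2 := by
  have hd : ∀ t : ℝ, HasDerivAt (fun t : ℝ => Real.exp t * (2 - 2 * t + t ^ 2 - t ^ 3 / 3))
      (-(Real.exp t * t ^ 3 / 3)) t := fun t => by
    have h := (Real.hasDerivAt_exp t).mul (((((hasDerivAt_id t).const_mul 2).const_sub 2).add
      ((hasDerivAt_id t).pow 2)).sub (((hasDerivAt_id t).pow 3).div_const 3))
    refine h.congr_deriv ?_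
    simp
    ring
  have hanti : AntitoneOn (fun t : ℝ => Real.exp t * (2 - 2 * t + t ^ 2 - t ^ 3 / 3)) (Ici 0) := by
    refine antitoneOn_of_deriv_nonpos (convex_Ici 0)
      (fun t _ => (hd t).continuousAt.continuousWithinAt)
      (fun t _ => (hd t).differentiableAt.differentiableWithinAt) fun t ht => ?_
    rw [interior_Ici] at ht
    have : 0 < t := ht
    rw [(hd t).deriv]
    have : 0 ≤ Real.exp t * t ^ 3 / 3 := by positivity
    linarith
  simpa using hanti (mem_Ici.mpr le_rfl) hx hx

/-- The numerator of the derivative of `boundFun`. -/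
def critFun (lam r : ℝ) : ℝ :=
  1 + r ^ 2 - 2 * lam * r ^ 3 - Real.exp (lam * r) * (1 - lam * r + r ^ 2 + lam * r ^ 3)

/-- The function of the radius whose maximum bounds the pre-Schwarzian norm. -/
def boundFun (lam r : ℝ) : ℝ := (1 - r ^ 2) * (Real.exp (lam * r) + lam * r - 1) / r

lemma hasDerivAt_exp_mul (lam r : ℝ) :
    HasDerivAt (fun r => Real.exp (lam * r)) (Real.exp (lam * r) * lam) r := by
  simpa using ((hasDerivAt_id r).const_mul lam).exp

lemma hasDerivAt_boundFun (lam : ℝ) {r : ℝ} (hr : r ≠ 0) :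
    HasDerivAt (boundFun lam) (critFun lam r / r ^ 2) r := by
  have h := ((((hasDerivAt_id r).pow 2).const_sub 1).mul
    (((hasDerivAt_exp_mul lam r).add ((hasDerivAt_id r).const_mul lam)).sub_const 1)).div
    (hasDerivAt_id r) hr
  refine h.congr_deriv ?_
  simp [critFun]
  ring

lemma hasDerivAt_critFun_div_sq (lam : ℝ) {r : ℝ} (hr : r ≠ 0) :
    HasDerivAt (fun r => critFun lam r / r ^ 2)
      (-(2 + 2 * lam * r ^ 3 - Real.exp (lam * r) *
        (2 - 2 * lam * r + lam ^ 2 * r ^ 2 - 2 * lam * r ^ 3 - lam ^ 2 * r ^ 4)) / r ^ 3) r := by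
  have hi := hasDerivAt_id r
  have h := (((((hi.pow 2).const_add 1).sub ((hi.pow 3).const_mul (2 * lam))).sub
    ((hasDerivAt_exp_mul lam r).mul ((((hi.const_mul lam).const_sub 1).add (hi.pow 2)).add
      ((hi.pow 3).const_mul lam))))).div (hi.pow 2) (pow_ne_zero 2 hr)
  refine h.congr_deriv ?_
  simp
  field_simp
  ring

lemma critFun_div_sq_antitoneOn {lam : ℝ} (h0 : 0 < lam) (h2 : lam ≤ 2) :
    AntitoneOn (fun r => critFun lam r / r ^ 2) (Ioi 0) := by
  refine antitoneOn_of_deriv_nonpos (convex_Ioi 0)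
    (fun r hr => (hasDerivAt_critFun_div_sq lam (ne_of_gt hr)).continuousAt.continuousWithinAt)
    (fun r hr => (hasDerivAt_critFun_div_sq lam
      (ne_of_gt (by simpa using hr))).differentiableAt.differentiableWithinAt) fun r hr => ?_
  rw [interior_Ioi] at hr
  have hr : 0 < r := hr
  rw [(hasDerivAt_critFun_div_sq lam hr.ne').deriv]
  refine div_nonpos_of_nonpos_of_nonneg (neg_nonpos.mpr ?_) (by positivity)
  have hE := Real.exp_pos (lam * r)
  have hT := exp_mul_cubic_taylor_le (x := lam * r) (by positivity)
  have h1 : 0 ≤ Real.exp (lam * r) * (lam * r ^ 3 * (4 - lam ^ 2)) := by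
    have : 0 ≤ 4 - lam ^ 2 := by nlinarith
    positivity
  have h3 : 0 ≤ Real.exp (lam * r) * (lam * r ^ 3) := by positivity
  have h4 : 0 ≤ Real.exp (lam * r) * (lam ^ 2 * r ^ 4) := by positivity
  have h5 : 0 ≤ lam * r ^ 3 := by positivity
  nlinarith

lemma boundFun_le_of_critFun_eq_zero {lam α s : ℝ} (h0 : 0 < lam) (h2 : lam ≤ 2) (hα : 0 < α)
    (hroot : critFun lam α = 0) (hs : 0 < s) : boundFun lam s ≤ boundFun lam α := by
  have hanti := critFun_div_sq_antitoneOn h0 h2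
  rcases le_total s α with h | h
  · have hm : MonotoneOn (boundFun lam) (Icc s α) := by
      refine monotoneOn_of_deriv_nonneg (convex_Icc s α)
        (fun r hr => (hasDerivAt_boundFun lam
          (hs.trans_le hr.1).ne').continuousAt.continuousWithinAt) (fun r hr => ?_) fun r hr => ?_
      all_goals rw [interior_Icc] at hr
      · exact (hasDerivAt_boundFun lam
          (hs.trans hr.1).ne').differentiableAt.differentiableWithinAt
      · rw [(hasDerivAt_boundFun lam (hs.trans hr.1).ne').deriv]
        simpa [hroot] using hanti (hs.trans hr.1) hα hr.2.le
    exact hm (left_mem_Icc.mpr h) (right_mem_Icc.mpr h) h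
  · have hm : AntitoneOn (boundFun lam) (Icc α s) := by
      refine antitoneOn_of_deriv_nonpos (convex_Icc α s)
        (fun r hr => (hasDerivAt_boundFun lam
          (hα.trans_le hr.1).ne').continuousAt.continuousWithinAt) (fun r hr => ?_) fun r hr => ?_
      all_goals rw [interior_Icc] at hr
      · exact (hasDerivAt_boundFun lam
          (hα.trans hr.1).ne').differentiableAt.differentiableWithinAt
      · rw [(hasDerivAt_boundFun lam (hα.trans hr.1).ne').deriv]
        simpa [hroot] using hanti hα (hα.trans hr.1) hr.1.le
    exact hm (left_mem_Icc.mpr h) (right_mem_Icc.mpr h) h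

lemma add_mul_exp_sub_one_div_le {lam α r s : ℝ} (h0 : 0 < lam) (h2 : lam ≤ 2) (hα : 0 < α)
    (hroot : critFun lam α = 0) (hs : 0 ≤ s) (hsr : s ≤ r) (hr : 0 < r) :
    lam * (1 - s ^ 2) + (1 - r ^ 2) * (Real.exp (lam * s) - 1) / r ≤ boundFun lam α := by
  rcases hs.eq_or_lt with rfl | hs
  · refine le_trans ?_ (boundFun_le_of_critFun_eq_zero h0 h2 hα hroot (s := 1 / 2) (by norm_num))
    have := Real.add_one_le_exp (lam * (1 / 2))
    rw [boundFun, le_div_iff₀ (by norm_num)]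
    simp
    linarith
  · refine le_trans ?_ (boundFun_le_of_critFun_eq_zero h0 h2 hα hroot hs)
    have hE : 0 ≤ Real.exp (lam * s) - 1 := by
      have := Real.add_one_le_exp (lam * s)
      have : 0 < lam * s := by positivity
      linarith
    have hmono : (1 - r ^ 2) / r ≤ (1 - s ^ 2) / s := by
      rw [div_le_div_iff₀ hr hs]
      nlinarith [mul_pos hr hs]
    calc lam * (1 - s ^ 2) + (1 - r ^ 2) * (Real.exp (lam * s) - 1) / r
        = lam * (1 - s ^ 2) + (1 - r ^ 2) / r * (Real.exp (lam * s) - 1) := by ring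
      _ ≤ lam * (1 - s ^ 2) + (1 - s ^ 2) / s * (Real.exp (lam * s) - 1) := by gcongr
      _ = boundFun lam s := by rw [boundFun]; field_simp; ring

lemma norm_exp_sub_one_le_exp_norm_sub_one (w : ℂ) :
    ‖Complex.exp w - 1‖ ≤ Real.exp ‖w‖ - 1 := by
  simpa using Complex.norm_exp_sub_sum_le_exp_norm_sub_sum w 1

/-- If `w f'(w) / f(w) = exp (λ ω(w))`, then `f'' / f' = λ ω' + (exp (λ ω) - 1) / z`. -/
lemma preSchwarzian_eq_of_sratio_eq_exp {lam : ℝ} {f ω : ℂ → ℂ}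
    (hf : AnalyticOnNhd ℂ f unitDisk) (hf0 : ∀ z ∈ unitDisk, z ≠ 0 → f z ≠ 0)
    (hω : AnalyticOnNhd ℂ ω unitDisk)
    (heq : EqOn (sratio f) ((fun z => Complex.exp ((lam : ℂ) * z)) ∘ ω) unitDisk)
    {z : ℂ} (hz : z ∈ unitDisk) (hz0 : z ≠ 0) :
    deriv (deriv f) z / deriv f z = lam * deriv ω z + (Complex.exp (lam * ω z) - 1) / z := by
  have hform : ∀ w ∈ unitDisk, w ≠ 0 → deriv f w = Complex.exp (lam * ω w) * f w / w := by
    intro w hw hw0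
    have h := heq hw
    simp only [sratio, hw0, if_false, Function.comp_apply] at h
    rw [← h]
    field_simp [hf0 w hw hw0]
  have hev : deriv f =ᶠ[nhds z] fun w => Complex.exp (lam * ω w) * f w / w := by
    filter_upwards [isOpen_ball.mem_nhds hz, isOpen_ne.mem_nhds hz0] with w hw hw0
    exact hform w hw hw0
  have hder := (((((hω z hz).differentiableAt.hasDerivAt).const_mul (lam : ℂ)).cexp.mul
    (hf z hz).differentiableAt.hasDerivAt).div (hasDerivAt_id z) hz0)
  have hd2 := (hder.congr_of_eventuallyEq hev).deriv
  have hfz := hf0 z hz hz0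
  have hE := Complex.exp_ne_zero (lam * ω z)
  rw [hd2, hform z hz hz0]
  simp only [id, Pi.mul_apply]
  field_simp
  ring

/-- Pre-Schwarzian norm estimate for the class S*_{λe}. -/
theorem preSchwarzian_bound_Sstar_lambda_e (lam : ℝ) (hlam₀ : 0 < lam)
    (hlam₁ : lam ≤ Real.pi / 2) (f : ℂ → ℂ)
    (hf : MemSstar (fun z => Complex.exp ((lam:ℂ) * z)) f)
    (α : ℝ) (hα : α ∈ Set.Ioo (0:ℝ) 1)
    (hroot : 1 + α^2 - 2*lam*α^3 - Real.exp (lam*α) * (1 - lam*α + α^2 + lam*α^3) = 0) :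
    ∀ z ∈ unitDisk, (1 - ‖z‖^2) * ‖deriv (deriv f) z / deriv f z‖ ≤
      (1 - α^2) * (Real.exp (lam*α) + lam*α - 1) / α := by
  obtain ⟨⟨hfa, -, hf1⟩, hf0, ω, hωa, hω0, hωmaps, heq⟩ := hf
  have h2 : lam ≤ 2 := by linarith [Real.pi_le_four]
  have hpunct : ∀ z ∈ unitDisk, z ≠ 0 →
      (1 - ‖z‖ ^ 2) * ‖deriv (deriv f) z / deriv f z‖ ≤ boundFun lam α := by
    intro z hz hz0
    have hz1 : ‖z‖ < 1 := by simpa [unitDisk] using hz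
    have hr : 0 < ‖z‖ := norm_pos_iff.mpr hz0
    have hSP := schwarzPick_norm_deriv_le hωa.differentiableOn hωmaps hz1
    have hS : ‖ω z‖ ≤ ‖z‖ := Complex.norm_le_norm_of_mapsTo_ball hωa.differentiableOn
      (hωmaps.mono_right ball_subset_closedBall) hω0 hz1
    have hp : 0 ≤ 1 - ‖z‖ ^ 2 := by nlinarith
    have hnl : ∀ w : ℂ, ‖(lam : ℂ) * w‖ = lam * ‖w‖ := fun w => by
      rw [norm_mul, Complex.norm_real, Real.norm_of_nonneg hlam₀.le]
    have hexp := norm_exp_sub_one_le_exp_norm_sub_one (lam * ω z)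
    rw [hnl] at hexp
    rw [preSchwarzian_eq_of_sratio_eq_exp hfa hf0 hωa heq hz hz0]
    calc (1 - ‖z‖ ^ 2) * ‖lam * deriv ω z + (Complex.exp (lam * ω z) - 1) / z‖
        ≤ (1 - ‖z‖ ^ 2) * (lam * ‖deriv ω z‖ + (Real.exp (lam * ‖ω z‖) - 1) / ‖z‖) := by
          refine mul_le_mul_of_nonneg_left ((norm_add_le _ _).trans ?_) hp
          rw [hnl, norm_div]
          gcongr
      _ = lam * ((1 - ‖z‖ ^ 2) * ‖deriv ω z‖) +
            (1 - ‖z‖ ^ 2) * (Real.exp (lam * ‖ω z‖) - 1) / ‖z‖ := by ring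
      _ ≤ lam * (1 - ‖ω z‖ ^ 2) +
            (1 - ‖z‖ ^ 2) * (Real.exp (lam * ‖ω z‖) - 1) / ‖z‖ := by gcongr
      _ ≤ boundFun lam α :=
          add_mul_exp_sub_one_div_le hlam₀ h2 hα.1 hroot (norm_nonneg _) hS hr
  intro z hz
  rcases eq_or_ne z 0 with rfl | hz0
  · have hc : ContinuousAt
        (fun z : ℂ => (1 - ‖z‖ ^ 2) * ‖deriv (deriv f) z / deriv f z‖) 0 :=
      (by fun_prop : ContinuousAt (fun z : ℂ => 1 - ‖z‖ ^ 2) 0).mul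
        (((hfa 0 hz).deriv.deriv.continuousAt.div (hfa 0 hz).deriv.continuousAt
          (by rw [hf1]; exact one_ne_zero)).norm)
    refine le_of_tendsto (hc.tendsto.mono_left (nhdsWithin_le_nhds (s := {0}ᶜ))) ?_
    filter_upwards [nhdsWithin_le_nhds (isOpen_ball.mem_nhds hz), self_mem_nhdsWithin]
      with w hw hw0 using hpunct w hw hw0
  · exact hpunct z hz hz0
end
end

section
/- Fix c with 0 < c ≤ 1, and for 0 < s < 1 define k₁(s) = (1 − cs)²(−8 + 12cs − 3c²s² − 4cs³ + 3c²s⁴), k₂(s) = −4√(1 − cs)·(−2 + 6cs − 6c²s² + cs³ + c³s³), and k(s) = (k₁(s) + k₂(s))/(1 − cs)^{7/2}. Then k(s) < 0 for all s ∈ (0,1). -/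
/-- Technical lemma: for fixed 0 < c ≤ 1 and 0 < s < 1,
k(s) = (k₁(s) + k₂(s))/(1 − cs)^{7/2} < 0, where
k₁(s) = (1 − cs)²(−8 + 12cs − 3c²s² − 4cs³ + 3c²s⁴) and
k₂(s) = −4√(1 − cs)(−2 + 6cs − 6c²s² + cs³ + c³s³). -/
theorem technical_lemma_k_neg (c : ℝ) (hc₀ : 0 < c) (hc₁ : c ≤ 1)
    (s : ℝ) (hs : s ∈ Set.Ioo (0:ℝ) 1) :
    ((1 - c*s)^2 * (-8 + 12*c*s - 3*c^2*s^2 - 4*c*s^3 + 3*c^2*s^4) +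
      (-4) * Real.sqrt (1 - c*s) * (-2 + 6*c*s - 6*c^2*s^2 + c*s^3 + c^3*s^3)) /
      (1 - c*s) ^ ((7:ℝ)/2) < 0 := by
  obtain ⟨hs₀, hs₁⟩ := hs
  have hx₀ : 0 < c * s := mul_pos hc₀ hs₀
  have hxs : c * s ≤ s := mul_le_of_le_one_left hs₀.le hc₁
  have hpos : 0 < 1 - c * s := by linarith
  refine div_neg_of_neg_of_pos ?_ (Real.rpow_pos_of_pos hpos _)
  set r := Real.sqrt (1 - c * s) with hr
  have hr₀ : 0 < r := Real.sqrt_pos.mpr hpos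
  have hr₂ : r ^ 2 = 1 - c * s := Real.sq_sqrt hpos.le
  have hr₁ : r < 1 := by nlinarith
  have hx : c * s = 1 - r ^ 2 := by linarith
  -- The numerator is affine in `s ^ 2` once `c * s` is fixed; expand it around `s = c * s`.
  have key : (1 - c*s)^2 * (-8 + 12*c*s - 3*c^2*s^2 - 4*c*s^3 + 3*c^2*s^4) +
      (-4) * r * (-2 + 6*c*s - 6*c^2*s^2 + c*s^3 + c^3*s^3) =
      -(r ^ 6 * (1 - r) ^ 3 * (3 * r ^ 3 + 9 * r ^ 2 + 10 * r + 6)) -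
      (s ^ 2 - (c * s) ^ 2) * (c * s * (r ^ 4 * (4 - 3 * (c * s)) + 4 * r)) := by
    have expand : (1 - c*s)^2 * (-8 + 12*c*s - 3*c^2*s^2 - 4*c*s^3 + 3*c^2*s^4) +
        (-4) * r * (-2 + 6*c*s - 6*c^2*s^2 + c*s^3 + c^3*s^3) =
        (1 - c*s)^2 * (-8 + 12*(c*s) - 3*(c*s)^2 - 4*(c*s)*s^2 + 3*(c*s)^2*s^2) +
        (-4) * r * (-2 + 6*(c*s) - 6*(c*s)^2 + (c*s)*s^2 + (c*s)^3) := by ring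
    rw [expand, hx]
    ring
  rw [key]
  have h₁ : 0 < r ^ 6 * (1 - r) ^ 3 * (3 * r ^ 3 + 9 * r ^ 2 + 10 * r + 6) := by
    have := sub_pos.mpr hr₁
    positivity
  have h₂ : 0 ≤ (s ^ 2 - (c * s) ^ 2) * (c * s * (r ^ 4 * (4 - 3 * (c * s)) + 4 * r)) := by
    have hsq : 0 ≤ s ^ 2 - (c * s) ^ 2 := sub_nonneg.mpr (pow_le_pow_left₀ hx₀.le hxs 2)
    have hlin : 0 < 4 - 3 * (c * s) := by linarith
    positivity
  linarith
end

section
/- Let 0 < c ≤ 1. Then the function r ↦ −2 + 4cr − (2 + c²)r² + 2cr³ − c²r⁴ + (1 − cr)^{3/2}(2 − cr + 2r² − 3cr³) has exactly one root in the open interval (0,1). -/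
/-- The polynomial in `s = √(1 - c r)` to which the equation reduces. -/
def reducedPoly (c s : ℝ) : ℝ :=
  (1 - c^2) * (1 + 2*s + s^2 + s^3) + s^4 * (3 - 5*s^2 - 3*s^3)

theorem lhs_eq_reducedPoly {c s : ℝ} (hc : c ≠ 0) (hs : 0 ≤ s) {r : ℝ} (hr : c * r = 1 - s^2) :
    -2 + 4*c*r - (2 + c^2)*r^2 + 2*c*r^3 - c^2*r^4 +
        (1 - c*r) ^ ((3:ℝ)/2) * (2 - c*r + 2*r^2 - 3*c*r^3) =
      -((1 - s)^2 * reducedPoly c s) / c^2 := by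
  have hpow : (1 - c*r) ^ ((3:ℝ)/2) = s^3 := by
    rw [show 1 - c*r = s^2 by linarith, ← Real.rpow_natCast s 2, ← Real.rpow_mul hs,
      ← Real.rpow_natCast s 3]
    norm_num
  obtain rfl : r = (1 - s^2) / c := by
    field_simp
    linarith
  rw [hpow, reducedPoly]
  field_simp
  ring

theorem reducedPoly_neg_of_lt {c s t : ℝ} (hc₀ : 0 < c) (hc₁ : c ≤ 1) (hs : 0 < s) (hst : s < t)
    (h : reducedPoly c s = 0) : reducedPoly c t < 0 := by
  have ht : 0 < t := hs.trans hst
  have hk : 0 ≤ 1 - c^2 := by nlinarith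
  have scaled : ∀ x : ℝ, 0 < x → reducedPoly c x / x^4 =
      (1 - c^2) * ((1/x)^4 + 2 * (1/x)^3 + (1/x)^2 + 1/x) + (3 - 5*x^2 - 3*x^3) := by
    intro x hx
    rw [reducedPoly]
    field_simp
  have hinv : 1/t ≤ 1/s := one_div_le_one_div_of_le hs hst.le
  have hinv₀ : 0 ≤ 1/t := by positivity
  have hsum : (1/t)^4 + 2 * (1/t)^3 + (1/t)^2 + 1/t ≤
      (1/s)^4 + 2 * (1/s)^3 + (1/s)^2 + 1/s := by gcongr
  have h₂ : s^2 < t^2 := by gcongr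
  have h₃ : s^3 < t^3 := by gcongr
  have hle := mul_le_mul_of_nonneg_left hsum hk
  have hs' := scaled s hs
  rw [h, zero_div] at hs'
  have hlt : reducedPoly c t / t^4 < 0 := by
    rw [scaled t ht]
    linarith
  rwa [div_lt_iff₀ (by positivity), zero_mul] at hlt

theorem reducedPoly_root_unique {c s t : ℝ} (hc₀ : 0 < c) (hc₁ : c ≤ 1) (hs : 0 < s) (ht : 0 < t)
    (h : reducedPoly c s = 0) (h' : reducedPoly c t = 0) : s = t := by
  rcases lt_trichotomy s t with hst | hst | hst
  · exact absurd h' (reducedPoly_neg_of_lt hc₀ hc₁ hs hst h).ne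
  · exact hst
  · exact absurd h (reducedPoly_neg_of_lt hc₀ hc₁ ht hst h').ne

theorem exists_reducedPoly_root {c : ℝ} (hc₀ : 0 < c) (hc₁ : c ≤ 1) :
    ∃ s ∈ Set.Ioo (0:ℝ) 1, reducedPoly c s = 0 := by
  have hcont : ContinuousOn (reducedPoly c) (Set.Icc (1/2) 1) := by
    unfold reducedPoly
    fun_prop
  have hleft : 0 < reducedPoly c (1/2) := by
    unfold reducedPoly
    nlinarith
  have hright : reducedPoly c 1 < 0 := by
    unfold reducedPoly
    nlinarith
  obtain ⟨s, hs, h⟩ := intermediate_value_Ioo' (by norm_num) hcont ⟨hright, hleft⟩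
  exact ⟨s, ⟨by linarith [hs.1], hs.2⟩, h⟩

theorem one_sub_sq_lt_of_reducedPoly_eq_zero {c s : ℝ} (hc₀ : 0 < c) (hs : s ∈ Set.Ioo (0:ℝ) 1)
    (h : reducedPoly c s = 0) : 1 - s^2 < c := by
  obtain ⟨hs₀, hs₁⟩ := hs
  refine lt_of_pow_lt_pow_left₀ 2 hc₀.le ?_
  have hq : 0 < 1 + 2*s + s^2 + s^3 := by positivity
  refine lt_of_mul_lt_mul_right ?_ hq.le
  have hpos : 0 < (1 + s)^2 * (1 - s) * (2*s^2 + 2*s^3 + 4*s^4) := by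
    have := sub_pos.2 hs₁
    positivity
  unfold reducedPoly at h
  linarith

/-- For 0 < c ≤ 1, the function
r ↦ −2 + 4cr − (2 + c²)r² + 2cr³ − c²r⁴ + (1 − cr)^{3/2}(2 − cr + 2r² − 3cr³)
has exactly one root in (0,1). -/
theorem unique_root_Sstar_qc (c : ℝ) (hc₀ : 0 < c) (hc₁ : c ≤ 1) :
    ∃! r : ℝ, r ∈ Set.Ioo (0:ℝ) 1 ∧
      -2 + 4*c*r - (2 + c^2)*r^2 + 2*c*r^3 - c^2*r^4 +
        (1 - c*r) ^ ((3:ℝ)/2) * (2 - c*r + 2*r^2 - 3*c*r^3) = 0 := by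
  obtain ⟨s, hs, h⟩ := exists_reducedPoly_root hc₀ hc₁
  refine ⟨(1 - s^2) / c, ⟨⟨?_, ?_⟩, ?_⟩, ?_⟩
  · have : 0 < 1 - s^2 := by nlinarith [hs.1, hs.2]
    positivity
  · rw [div_lt_one hc₀]
    exact one_sub_sq_lt_of_reducedPoly_eq_zero hc₀ hs h
  · rw [lhs_eq_reducedPoly hc₀.ne' hs.1.le (mul_div_cancel₀ _ hc₀.ne'), h]
    simp
  · rintro r ⟨⟨hr₀, hr₁⟩, hr⟩
    have hcr : 0 < 1 - c*r := by nlinarith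
    have hsq : c * r = 1 - √(1 - c*r)^2 := by
      rw [Real.sq_sqrt hcr.le]
      ring
    have hpos : 0 < √(1 - c*r) := Real.sqrt_pos.2 hcr
    have hne : 1 - √(1 - c*r) ≠ 0 := by
      intro h0
      rw [← sub_eq_zero.1 h0] at hsq
      nlinarith [mul_pos hc₀ hr₀]
    rw [lhs_eq_reducedPoly hc₀.ne' hpos.le hsq] at hr
    have hroot : reducedPoly c √(1 - c*r) = 0 := by
      simpa [hc₀.ne', hne] using hr
    rw [reducedPoly_root_unique hc₀ hc₁ hs.1 hpos h hroot, eq_div_iff hc₀.ne']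
    linarith
end

section
/- Let f ∈ S*(√(1+z)), i.e., f is a normalized analytic function on 𝔻 with z f'(z)/f(z) ≺ √(1 + z). Then the pre-Schwarzian norm of f satisfies ||P_f|| ≤ (1 + α)(2 − α − 2(1 − α)^{3/2})/(2α), where α is the unique root in (0,1) of the equation −2 − r² + (2 + r + 3r²)√(1 − r) = 0. -/
open Metric Set

noncomputable section

/-- A disk automorphism `u ↦ (u + a) / (1 + conj a * u)` preserves the unit disk. -/
lemma norm_moebius_lt_one {a u : ℂ} (ha : ‖a‖ < 1) (hu : ‖u‖ < 1) :
    1 + (starRingEnd ℂ) a * u ≠ 0 ∧ ‖(u + a) / (1 + (starRingEnd ℂ) a * u)‖ < 1 := by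
  have hlt : ‖u + a‖ < ‖1 + (starRingEnd ℂ) a * u‖ := by
    refine lt_of_pow_lt_pow_left₀ 2 (norm_nonneg _) ?_
    have ha2 : 0 < 1 - ‖a‖ ^ 2 := by nlinarith [norm_nonneg a]
    have hu2 : 0 < 1 - ‖u‖ ^ 2 := by nlinarith [norm_nonneg u]
    have hprod := mul_pos ha2 hu2
    rw [← Complex.normSq_eq_norm_sq, ← Complex.normSq_eq_norm_sq] at hprod ⊢
    simp only [Complex.normSq_apply, Complex.add_re, Complex.add_im, Complex.mul_re,
      Complex.mul_im, Complex.conj_re, Complex.conj_im, Complex.one_re, Complex.one_im] at hprod ⊢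
    nlinarith [hprod]
  have hpos : 0 < ‖1 + (starRingEnd ℂ) a * u‖ := (norm_nonneg _).trans_lt hlt
  refine ⟨norm_pos_iff.mp hpos, ?_⟩
  rw [norm_div, div_lt_one hpos]
  exact hlt

/-- The infinitesimal Schwarz–Pick inequality. -/
lemma norm_deriv_le_schwarz_pick {ω : ℂ → ℂ} (hd : DifferentiableOn ℂ ω (ball 0 1))
    (hm : MapsTo ω (ball 0 1) (ball 0 1)) {a : ℂ} (ha : ‖a‖ < 1) :
    (1 - ‖a‖ ^ 2) * ‖deriv ω a‖ ≤ 1 - ‖ω a‖ ^ 2 := by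
  have ha' : a ∈ ball (0 : ℂ) 1 := mem_ball_zero_iff.mpr ha
  have hb : ‖ω a‖ < 1 := mem_ball_zero_iff.mp (hm ha')
  have moebius_deriv (c u : ℂ) (h : 1 + (starRingEnd ℂ) c * u ≠ 0) :
      HasDerivAt (fun u => (u + c) / (1 + (starRingEnd ℂ) c * u))
        ((1 - (starRingEnd ℂ) c * c) / (1 + (starRingEnd ℂ) c * u) ^ 2) u := by
    refine (((hasDerivAt_id u).add_const c).div
      (((hasDerivAt_id u).const_mul ((starRingEnd ℂ) c)).const_add 1) h).congr_deriv ?_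
    simp only [id]
    ring
  set A : ℂ → ℂ := fun u => (u + a) / (1 + (starRingEnd ℂ) a * u) with hA
  set B : ℂ → ℂ := fun u => (u + -ω a) / (1 + (starRingEnd ℂ) (-ω a) * u) with hB
  have hb' : ‖-ω a‖ < 1 := by rwa [norm_neg]
  have hAmaps : MapsTo A (ball 0 1) (ball 0 1) := fun u hu =>
    mem_ball_zero_iff.mpr (norm_moebius_lt_one ha (mem_ball_zero_iff.mp hu)).2
  have hBmaps : MapsTo B (ball 0 1) (ball 0 1) := fun u hu =>
    mem_ball_zero_iff.mpr (norm_moebius_lt_one hb' (mem_ball_zero_iff.mp hu)).2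
  have hAd : DifferentiableOn ℂ A (ball 0 1) := fun u hu =>
    (moebius_deriv a u (norm_moebius_lt_one ha
      (mem_ball_zero_iff.mp hu)).1).differentiableAt.differentiableWithinAt
  have hBd : DifferentiableOn ℂ B (ball 0 1) := fun u hu =>
    (moebius_deriv (-ω a) u (norm_moebius_lt_one hb'
      (mem_ball_zero_iff.mp hu)).1).differentiableAt.differentiableWithinAt
  have hA0 : A 0 = a := by simp [hA]
  have hBb : B (ω a) = 0 := by simp [hB]
  have hcomp0 : (B ∘ ω ∘ A) 0 = 0 := by simp [hA0, hBb]
  have hbound : ‖deriv (B ∘ ω ∘ A) 0‖ ≤ 1 := by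
    refine Complex.norm_deriv_le_one_of_mapsTo_ball (R := 1)
      (hBd.comp (hd.comp hAd hAmaps) (hm.comp hAmaps)) ?_ one_pos
    rw [hcomp0]
    exact (hBmaps.comp (hm.comp hAmaps)).mono_right ball_subset_closedBall
  have hAderiv : HasDerivAt A (1 - ‖a‖ ^ 2 : ℂ) 0 := by
    convert moebius_deriv a 0 (by simp) using 1
    simp [Complex.conj_mul']
  have hBderiv : HasDerivAt B (1 / (1 - ‖ω a‖ ^ 2 : ℂ)) (ω a) := by
    convert moebius_deriv (-ω a) (ω a) (norm_moebius_lt_one hb' hb).1 using 1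
    have hne : (1 - ‖ω a‖ ^ 2 : ℂ) ≠ 0 := by
      have : 1 - ‖ω a‖ ^ 2 ≠ 0 := by nlinarith [norm_nonneg (ω a)]
      exact_mod_cast this
    simp only [map_neg, neg_mul, mul_neg, neg_neg, Complex.conj_mul', ← sub_eq_add_neg]
    field_simp
  have hωderiv : HasDerivAt ω (deriv ω a) (A 0) := by
    rw [hA0]
    exact (hd.differentiableAt (isOpen_ball.mem_nhds ha')).hasDerivAt
  have hderiv : HasDerivAt (B ∘ ω ∘ A)
      (1 / (1 - ‖ω a‖ ^ 2 : ℂ) * (deriv ω a * (1 - ‖a‖ ^ 2 : ℂ))) 0 := by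
    refine HasDerivAt.comp 0 ?_ (hωderiv.comp 0 hAderiv)
    simpa [hA0] using hBderiv
  have hbpos : 0 < 1 - ‖ω a‖ ^ 2 := by nlinarith [norm_nonneg (ω a)]
  have hapos : 0 < 1 - ‖a‖ ^ 2 := by nlinarith [norm_nonneg a]
  have hnb : ‖(1 - ‖ω a‖ ^ 2 : ℂ)‖ = 1 - ‖ω a‖ ^ 2 := by
    rw [← Complex.norm_of_nonneg hbpos.le]
    push_cast
    rfl
  have hna : ‖(1 - ‖a‖ ^ 2 : ℂ)‖ = 1 - ‖a‖ ^ 2 := by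
    rw [← Complex.norm_of_nonneg hapos.le]
    push_cast
    rfl
  rw [hderiv.deriv, norm_mul, norm_mul, norm_div, norm_one, hna, hnb, one_div,
    inv_mul_le_iff₀ hbpos] at hbound
  linarith

lemma re_cpow_half_nonneg (x : ℂ) : 0 ≤ (x ^ ((1 : ℂ) / 2)).re := by
  rw [one_div, Complex.cpow_inv_two_re]
  positivity

lemma cpow_half_sq (x : ℂ) : (x ^ ((1 : ℂ) / 2)) ^ 2 = x := by
  rw [one_div]
  exact Complex.cpow_ofNat_inv_pow x 2

lemma norm_sqrt_one_add_sub_one_le {w : ℂ} (hw : ‖w‖ < 1) :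
    ‖(1 + w) ^ ((1 : ℂ) / 2) - 1‖ ≤ 1 - √(1 - ‖w‖) := by
  have hre := re_cpow_half_nonneg (1 + w)
  have hsq := cpow_half_sq (1 + w)
  set p := (1 + w) ^ ((1 : ℂ) / 2)
  have hnorm : ‖w‖ = ‖p - 1‖ * ‖p + 1‖ := by
    rw [← norm_mul]
    congr 1
    linear_combination -hsq
  have hone : 1 ≤ ‖p + 1‖ := by
    have := Complex.re_le_norm (p + 1)
    simp only [Complex.add_re, Complex.one_re] at this
    linarith
  have htwo : 2 ≤ ‖p + 1‖ + ‖p - 1‖ := by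
    have := norm_sub_le (p + 1) (p - 1)
    rw [show p + 1 - (p - 1) = 2 by ring, Complex.norm_two] at this
    exact this
  have hp0 := norm_nonneg (p - 1)
  have hp1 : ‖p - 1‖ ≤ 1 := by nlinarith
  have : √(1 - ‖w‖) ≤ 1 - ‖p - 1‖ := by
    refine Real.sqrt_le_iff.mpr ⟨by linarith, ?_⟩
    nlinarith
  linarith

/-- The pre-Schwarzian derivative of `f` at a nonzero point near which `sratio f = √(1 + ω)`. -/
lemma preSchwarzian_eq_of_sratio_eq {f ω : ℂ → ℂ} {z : ℂ} (hz : z ≠ 0) (hfz : f z ≠ 0)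
    (hf : DifferentiableAt ℂ f z) (hω : DifferentiableAt ℂ ω z)
    (hslit : 1 + ω z ∈ Complex.slitPlane)
    (heq : ∀ᶠ v in nhds z, deriv f v = f v * (1 + ω v) ^ ((1 : ℂ) / 2) / v) :
    deriv (deriv f) z / deriv f z =
      ((1 + ω z) ^ ((1 : ℂ) / 2) - 1) / z + deriv ω z / (2 * (1 + ω z)) := by
  have hne : 1 + ω z ≠ 0 := Complex.slitPlane_ne_zero hslit
  have hp := (hω.hasDerivAt.const_add 1).cpow_const (c := (1 : ℂ) / 2) hslit
  have hd := ((hf.hasDerivAt.mul hp).div (hasDerivAt_id z) hz).congr_of_eventuallyEq heq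
  have hf' := heq.self_of_nhds
  rw [hd.deriv]
  rw [Complex.cpow_sub _ _ hne, Complex.cpow_one]
  have hp0 : (1 + ω z) ^ ((1 : ℂ) / 2) ≠ 0 := by
    rw [Ne, Complex.cpow_eq_zero_iff]
    tauto
  simp only [id, Pi.mul_apply]
  rw [hf']
  generalize (1 + ω z) ^ ((1 : ℂ) / 2) = p at *
  generalize 1 + ω z = q at *
  field_simp
  ring

/-- The extremal function is maximal at the critical point: `s` and `σ` stand for `√(1 - r)`. -/
lemma extremal_le_of_cubic {s σ : ℝ} (hs : 0 < s) (hσ : 0 < σ) (hσ1 : σ < 1)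
    (hcubic : 3 * σ ^ 3 + 5 * σ ^ 2 = 3) :
    (2 - s ^ 2) * (1 + s + 2 * s ^ 2) / (2 * (1 + s)) ≤
      (2 - σ ^ 2) * (1 + σ + 2 * σ ^ 2) / (2 * (1 + σ)) := by
  rw [div_le_div_iff₀ (by positivity) (by positivity)]
  have hQ : 0 ≤ 2 * (1 + σ) * s ^ 2 + (1 + σ) * (1 + 4 * σ) * s + (3 - σ - 2 * σ ^ 2) := by
    have : 0 ≤ 3 - σ - 2 * σ ^ 2 := by nlinarith
    positivity
  have h := mul_nonneg (sq_nonneg (s - σ)) hQ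
  have key : 2 * ((2 - σ ^ 2) * (1 + σ + 2 * σ ^ 2) * (1 + s)
      - (2 - s ^ 2) * (1 + s + 2 * s ^ 2) * (1 + σ)) =
      2 * ((s - σ) ^ 2 * (2 * (1 + σ) * s ^ 2 + (1 + σ) * (1 + 4 * σ) * s
        + (3 - σ - 2 * σ ^ 2))) := by
    linear_combination (4 * s * (s - σ)) * hcubic
  linarith

lemma cubic_of_root {σ : ℝ} (hσ1 : σ < 1)
    (h : -2 - (1 - σ ^ 2) ^ 2 + (2 + (1 - σ ^ 2) + 3 * (1 - σ ^ 2) ^ 2) * σ = 0) :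
    3 * σ ^ 3 + 5 * σ ^ 2 = 3 := by
  have hne : (σ - 1) ^ 2 ≠ 0 := pow_ne_zero 2 (by linarith)
  have : (σ - 1) ^ 2 * (3 * σ ^ 3 + 5 * σ ^ 2 - 3) = 0 := by linear_combination h
  linarith [(mul_eq_zero.mp this).resolve_left hne]

/-- The function of `r` bounding `(1 - r²)|P_f|` on `|z| = r`, in terms of `√(1 - r)`. -/
lemma extremal_eq {r : ℝ} (hr0 : 0 < r) (hr1 : r < 1) :
    (1 - r ^ 2) * (1 - √(1 - r)) / r + (1 + r) / 2 =
      (2 - √(1 - r) ^ 2) * (1 + √(1 - r) + 2 * √(1 - r) ^ 2) / (2 * (1 + √(1 - r))) := by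
  have hs2 : √(1 - r) ^ 2 = 1 - r := Real.sq_sqrt (by linarith)
  have hs0 : 0 ≤ √(1 - r) := Real.sqrt_nonneg _
  generalize √(1 - r) = s at *
  obtain rfl : r = 1 - s ^ 2 := by linarith
  have h1 : 1 - s ≠ 0 := by
    rintro h
    obtain rfl : s = 1 := by linarith
    norm_num at hr0
  have h2 : 1 + s ≠ 0 := by linarith
  rw [show 1 - s ^ 2 = (1 - s) * (1 + s) by ring]
  field_simp
  ring

lemma extremal_rpow_eq {r : ℝ} (hr0 : 0 < r) (hr1 : r < 1) :
    (1 + r) * (2 - r - 2 * (1 - r) ^ ((3 : ℝ) / 2)) / (2 * r) =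
      (1 - r ^ 2) * (1 - √(1 - r)) / r + (1 + r) / 2 := by
  have : (1 - r) ^ ((3 : ℝ) / 2) = (1 - r) * √(1 - r) := by
    rw [Real.sqrt_eq_rpow, show (3 : ℝ) / 2 = 1 + 1 / 2 by norm_num,
      Real.rpow_add (by linarith), Real.rpow_one]
  rw [this]
  field_simp
  ring

/-- The pointwise bound away from the origin. -/
lemma preSchwarzian_le_extremal {f : ℂ → ℂ}
    (hf : MemSstar (fun z => (1 + z) ^ ((1 : ℂ) / 2)) f) {z : ℂ} (hz : z ∈ unitDisk)
    (hz0 : z ≠ 0) :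
    (1 - ‖z‖ ^ 2) * ‖deriv (deriv f) z / deriv f z‖ ≤
      (1 - ‖z‖ ^ 2) * (1 - √(1 - ‖z‖)) / ‖z‖ + (1 + ‖z‖) / 2 := by
  obtain ⟨⟨hfan, -, -⟩, hfne, ω, hωan, hω0, hωm, hωeq⟩ := hf
  have hopen : IsOpen unitDisk := isOpen_ball
  have hz1 : ‖z‖ < 1 := mem_ball_zero_iff.mp hz
  have hw1 : ‖ω z‖ < 1 := mem_ball_zero_iff.mp (hωm hz)
  have hschwarz : ‖ω z‖ ≤ ‖z‖ := Complex.norm_le_norm_of_mapsTo_ball (R := 1)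
    hωan.differentiableOn (hωm.mono_right ball_subset_closedBall) hω0 hz1
  have hpick := norm_deriv_le_schwarz_pick hωan.differentiableOn hωm hz1
  have hslit : 1 + ω z ∈ Complex.slitPlane := by
    left
    have := (abs_le.mp (Complex.abs_re_le_norm (ω z))).1
    simp only [Complex.add_re, Complex.one_re]
    linarith
  have heq : ∀ᶠ v in nhds z, deriv f v = f v * (1 + ω v) ^ ((1 : ℂ) / 2) / v := by
    filter_upwards [hopen.mem_nhds hz, isOpen_ne.mem_nhds hz0] with v hv hv0
    have hv0' : v ≠ 0 := hv0
    have h := hωeq hv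
    simp only [sratio, if_neg hv0', Function.comp_apply] at h
    rw [← h]
    field_simp [hfne v hv hv0']
  rw [preSchwarzian_eq_of_sratio_eq hz0 (hfne z hz hz0) (hfan z hz).differentiableAt
    (hωan z hz).differentiableAt hslit heq]
  have hr0 : 0 < ‖z‖ := norm_pos_iff.mpr hz0
  have hr2 : 0 < 1 - ‖z‖ ^ 2 := by nlinarith
  have hfirst : ‖((1 + ω z) ^ ((1 : ℂ) / 2) - 1) / z‖ ≤ (1 - √(1 - ‖z‖)) / ‖z‖ := by
    rw [norm_div]
    have : √(1 - ‖z‖) ≤ √(1 - ‖ω z‖) := Real.sqrt_le_sqrt (by linarith)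
    gcongr
    linarith [norm_sqrt_one_add_sub_one_le hw1]
  have hsecond : (1 - ‖z‖ ^ 2) * ‖deriv ω z / (2 * (1 + ω z))‖ ≤ (1 + ‖z‖) / 2 := by
    have hlow : 1 - ‖ω z‖ ≤ ‖1 + ω z‖ := by
      have := norm_sub_norm_le 1 (-ω z)
      simpa using this
    rw [norm_div, norm_mul, Complex.norm_two, ← mul_div_assoc,
      div_le_div_iff₀ (by linarith) two_pos]
    nlinarith [norm_nonneg (ω z), mul_le_mul_of_nonneg_left hlow hr0.le]
  calc _ ≤ (1 - ‖z‖ ^ 2) * (‖((1 + ω z) ^ ((1 : ℂ) / 2) - 1) / z‖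
        + ‖deriv ω z / (2 * (1 + ω z))‖) := by gcongr; exact norm_add_le _ _
    _ ≤ (1 - ‖z‖ ^ 2) * ((1 - √(1 - ‖z‖)) / ‖z‖) + (1 + ‖z‖) / 2 := by
      rw [mul_add]
      gcongr
    _ = _ := by rw [mul_div_assoc]

/-- Pre-Schwarzian norm estimate for the class S*(√(1+z)). -/
theorem preSchwarzian_bound_Sstar_sqrt (f : ℂ → ℂ)
    (hf : MemSstar (fun z => (1 + z) ^ ((1:ℂ)/2)) f)
    (α : ℝ) (hα : α ∈ Set.Ioo (0:ℝ) 1)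
    (hroot : -2 - α^2 + (2 + α + 3*α^2) * Real.sqrt (1 - α) = 0) :
    ∀ z ∈ unitDisk, (1 - ‖z‖^2) * ‖deriv (deriv f) z / deriv f z‖ ≤
      (1 + α) * (2 - α - 2*(1 - α) ^ ((3:ℝ)/2)) / (2*α) := by
  have hσpos : 0 < √(1 - α) := Real.sqrt_pos.mpr (by linarith [hα.2])
  have hσlt : √(1 - α) < 1 := by
    rw [Real.sqrt_lt' one_pos]
    linarith [hα.1]
  have hσsq : √(1 - α) ^ 2 = 1 - α := Real.sq_sqrt (by linarith [hα.2])
  have hcubic : 3 * √(1 - α) ^ 3 + 5 * √(1 - α) ^ 2 = 3 := by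
    refine cubic_of_root hσlt ?_
    rw [hσsq]
    linear_combination hroot
  rw [extremal_rpow_eq hα.1 hα.2, extremal_eq hα.1 hα.2]
  have hpunctured : ∀ z ∈ unitDisk, z ≠ 0 →
      (1 - ‖z‖ ^ 2) * ‖deriv (deriv f) z / deriv f z‖ ≤
      (2 - √(1 - α) ^ 2) * (1 + √(1 - α) + 2 * √(1 - α) ^ 2) / (2 * (1 + √(1 - α))) := by
    intro z hz hz0
    have hz1 : ‖z‖ < 1 := mem_ball_zero_iff.mp hz
    refine (preSchwarzian_le_extremal hf hz hz0).trans ?_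
    rw [extremal_eq (norm_pos_iff.mpr hz0) hz1]
    exact extremal_le_of_cubic (Real.sqrt_pos.mpr (by linarith)) hσpos hσlt hcubic
  intro z hz
  rcases eq_or_ne z 0 with rfl | hz0
  · have hfan := hf.1.1
    have hcont : ContinuousAt
        (fun z => (1 - ‖z‖ ^ 2) * ‖deriv (deriv f) z / deriv f z‖) 0 :=
      (continuousAt_const.sub (continuous_norm.continuousAt.pow 2)).mul
        ((hfan.deriv.deriv 0 hz).continuousAt.div (hfan.deriv 0 hz).continuousAt
          (by simp [hf.1.2.2])).norm
    refine le_of_tendsto (hcont.tendsto.mono_left (nhdsWithin_le_nhds (s := {0}ᶜ))) ?_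
    filter_upwards [mem_nhdsWithin_of_mem_nhds (isOpen_ball.mem_nhds hz),
      self_mem_nhdsWithin] with v hv hv0
    exact hpunctured v hv hv0
  · exact hpunctured z hz hz0
end
end

section
/- Let 0 < λ ≤ π/2, let f ∈ S*_{λe}, and let J[f](z) = ∫₀^z f(t)/t dt be the Alexander transform of f. Then the pre-Schwarzian norm of J[f] satisfies ||P_{J[f]}|| ≤ (1 − α²)(e^{λα} − 1)/α, where α is the unique root in (0,1) of the equation λr e^{λr}(1 − r²) − (1 + r²)(e^{λr} − 1) = 0. -/
open Metric Set

noncomputable section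

/-- The Alexander transform J[f](z) = ∫₀^z f(t)/t dt (along the segment from 0 to z),
where f(t)/t is extended by its value 1 at t = 0. -/
def alexander (f : ℂ → ℂ) (z : ℂ) : ℂ :=
  z * ∫ s in (0:ℝ)..1, (if (s:ℂ) * z = 0 then 1 else f ((s:ℂ) * z) / ((s:ℂ) * z))

/-- If the derivative of `F` is `Q` on `(0, 1)`, `Q` is antitone and vanishes at `a`, then `F` is
maximal at `a`. -/
lemma le_of_hasDerivAt_antitoneOn {F Q : ℝ → ℝ} {a r : ℝ}
    (hF : ∀ x ∈ Ioo (0:ℝ) 1, HasDerivAt F (Q x) x) (hQ : AntitoneOn Q (Ioo 0 1))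
    (ha : a ∈ Ioo (0:ℝ) 1) (hQa : Q a = 0)
    (hr : r ∈ Ioo (0:ℝ) 1) : F r ≤ F a := by
  rcases le_total r a with h | h
  · have hsub : Icc r a ⊆ Ioo (0:ℝ) 1 := Icc_subset_Ioo hr.1 ha.2
    refine monotoneOn_of_hasDerivWithinAt_nonneg (convex_Icc r a)
      (fun x hx => (hF x (hsub hx)).continuousAt.continuousWithinAt)
      (fun x hx => (hF x (hsub (interior_subset hx))).hasDerivWithinAt) (fun x hx => ?_)
      (left_mem_Icc.2 h) (right_mem_Icc.2 h) h
    have hx := interior_subset hx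
    exact hQa ▸ hQ (hsub hx) ha hx.2
  · have hsub : Icc a r ⊆ Ioo (0:ℝ) 1 := Icc_subset_Ioo ha.1 hr.2
    refine antitoneOn_of_hasDerivWithinAt_nonpos (convex_Icc a r)
      (fun x hx => (hF x (hsub hx)).continuousAt.continuousWithinAt)
      (fun x hx => (hF x (hsub (interior_subset hx))).hasDerivWithinAt) (fun x hx => ?_)
      (left_mem_Icc.2 h) (right_mem_Icc.2 h) h
    have hx := interior_subset hx
    exact hQa ▸ hQ ha (hsub hx) hx.1

lemma hasDerivAt_exp_const_mul (c x : ℝ) :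
    HasDerivAt (fun r => Real.exp (c * r)) (c * Real.exp (c * x)) x := by
  simpa [mul_comm] using ((hasDerivAt_id x).const_mul c).exp

lemma hasDerivAt_criticalFun (c x : ℝ) :
    HasDerivAt
      (fun r => c * r * Real.exp (c * r) * (1 - r ^ 2) - (1 + r ^ 2) * (Real.exp (c * r) - 1))
      (x * (Real.exp (c * x) * (c ^ 2 * (1 - x ^ 2) - 4 * c * x - 2) + 2)) x := by
  have hE := hasDerivAt_exp_const_mul c x
  have hsq := hasDerivAt_pow 2 x
  refine (((((hasDerivAt_id x).const_mul c).mul hE).mul (hsq.const_sub 1)).sub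
    ((hsq.const_add 1).mul (hE.sub_const 1))).congr_deriv ?_
  simp
  ring

lemma criticalFun_second_order_nonpos {c : ℝ} (hc₀ : 0 < c) (hc₂ : c ≤ 2) {x : ℝ}
    (hx : x ∈ Icc (0:ℝ) 1) :
    x ^ 2 * (Real.exp (c * x) * (c ^ 2 * (1 - x ^ 2) - 4 * c * x - 2) + 2) -
      2 * (c * x * Real.exp (c * x) * (1 - x ^ 2) - (1 + x ^ 2) * (Real.exp (c * x) - 1)) ≤ 0 := by
  have hderiv : ∀ x : ℝ, HasDerivAt
      (fun x => x ^ 2 * (Real.exp (c * x) * (c ^ 2 * (1 - x ^ 2) - 4 * c * x - 2) + 2) -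
      2 * (c * x * Real.exp (c * x) * (1 - x ^ 2) - (1 + x ^ 2) * (Real.exp (c * x) - 1)))
      (x ^ 2 * (c * Real.exp (c * x) * (c ^ 2 * (1 - x ^ 2) - 6 * c * x - 6))) x := by
    intro x
    have hsq := hasDerivAt_pow 2 x
    have hM := ((hasDerivAt_exp_const_mul c x).mul ((((hsq.const_sub 1).const_mul (c ^ 2)).sub
      ((hasDerivAt_id x).const_mul (4 * c))).sub_const 2)).add_const 2
    refine ((hsq.mul hM).sub ((hasDerivAt_criticalFun c x).const_mul 2)).congr_deriv ?_
    simp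
    ring
  have hanti := antitoneOn_of_hasDerivWithinAt_nonpos (convex_Icc (0:ℝ) 1)
    (fun x _ => (hderiv x).continuousAt.continuousWithinAt)
    (fun x _ => (hderiv x).hasDerivWithinAt) (fun x hx => by
      have hx := interior_subset hx
      have h0 := hx.1
      refine mul_nonpos_of_nonneg_of_nonpos (sq_nonneg x)
        (mul_nonpos_of_nonneg_of_nonpos (by positivity) ?_)
      nlinarith [mul_nonneg (sq_nonneg c) (sq_nonneg x), mul_nonneg hc₀.le h0])
  simpa using hanti (left_mem_Icc.2 zero_le_one) hx hx.1

lemma radial_bound {c : ℝ} (hc₀ : 0 < c) (hc₂ : c ≤ 2) {a r : ℝ} (ha : a ∈ Ioo (0:ℝ) 1)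
    (hroot : c * a * Real.exp (c * a) * (1 - a ^ 2) - (1 + a ^ 2) * (Real.exp (c * a) - 1) = 0)
    (hr : r ∈ Ioo (0:ℝ) 1) :
    (1 - r ^ 2) * (Real.exp (c * r) - 1) / r ≤ (1 - a ^ 2) * (Real.exp (c * a) - 1) / a := by
  refine le_of_hasDerivAt_antitoneOn (F := fun r => (1 - r ^ 2) * (Real.exp (c * r) - 1) / r)
    (Q := fun r => (c * r * Real.exp (c * r) * (1 - r ^ 2) -
      (1 + r ^ 2) * (Real.exp (c * r) - 1)) / r ^ 2) (fun x hx => ?_) ?_ ha (by simp [hroot]) hr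
  · have hE := hasDerivAt_exp_const_mul c x
    have hx0 := hx.1.ne'
    refine ((((hasDerivAt_pow 2 x).const_sub 1).mul (hE.sub_const 1)).div
      (hasDerivAt_id x) hx0).congr_deriv ?_
    simp
    ring
  · have hderiv : ∀ x ∈ Ioo (0:ℝ) 1, HasDerivAt (fun r => (c * r * Real.exp (c * r) * (1 - r ^ 2) -
        (1 + r ^ 2) * (Real.exp (c * r) - 1)) / r ^ 2) _ x := fun x hx =>
      (hasDerivAt_criticalFun c x).div (hasDerivAt_pow 2 x) (pow_ne_zero 2 hx.1.ne')
    refine antitoneOn_of_hasDerivWithinAt_nonpos (convex_Ioo (0:ℝ) 1)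
      (fun x hx => (hderiv x hx).continuousAt.continuousWithinAt)
      (fun x hx => (hderiv x (interior_subset hx)).hasDerivWithinAt) (fun x hx => ?_)
    have hx := interior_subset hx
    have h := criticalFun_second_order_nonpos hc₀ hc₂ (Ioo_subset_Icc_self hx)
    refine div_nonpos_of_nonpos_of_nonneg ?_ (by positivity)
    have := mul_nonpos_of_nonneg_of_nonpos hx.1.le h
    norm_num
    linarith

lemma differentiableOn_dslope_zero {f : ℂ → ℂ} (hf : AnalyticOnNhd ℂ f unitDisk) :
    DifferentiableOn ℂ (dslope f 0) (ball 0 1) :=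
  (Complex.differentiableOn_dslope (ball_mem_nhds 0 one_pos)).2 hf.differentiableOn

lemma hasDerivAt_alexander {f : ℂ → ℂ} (hf : IsNormalized f) {z : ℂ} (hz : z ∈ unitDisk) :
    HasDerivAt (alexander f) (dslope f 0 z) z := by
  obtain ⟨han, h0, h1⟩ := hf
  have hd := differentiableOn_dslope_zero han
  obtain ⟨g, hg⟩ := hd.isExactOn_ball
  have hseg : ∀ w ∈ unitDisk, ∀ s ∈ uIcc (0:ℝ) 1, (s:ℂ) * w ∈ ball (0:ℂ) 1 := by
    intro w hw s hs
    rw [uIcc_of_le zero_le_one] at hs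
    rw [unitDisk, mem_ball_zero_iff] at hw
    rw [mem_ball_zero_iff, norm_mul, Complex.norm_real, Real.norm_of_nonneg hs.1]
    nlinarith [hs.2, norm_nonneg w]
  have heq : ∀ w ∈ unitDisk, alexander f w = g w - g 0 := by
    intro w hw
    have hderiv : ∀ s ∈ uIcc (0:ℝ) 1,
        HasDerivAt (fun s : ℝ => g ((s:ℂ) * w)) (w * dslope f 0 ((s:ℂ) * w)) s := by
      intro s hs
      have hlin := (hasDerivAt_id (s:ℂ)).mul_const w
      exact ((hg _ (hseg w hw s hs)).comp (s:ℂ) hlin).comp_ofReal.congr_deriv (by ring)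
    have hcont : ContinuousOn (fun s : ℝ => w * dslope f 0 ((s:ℂ) * w)) (uIcc 0 1) :=
      continuousOn_const.mul (hd.continuousOn.comp (by fun_prop) (hseg w hw))
    have hint := intervalIntegral.integral_eq_sub_of_hasDerivAt hderiv hcont.intervalIntegrable
    rw [intervalIntegral.integral_const_mul] at hint
    simp only [Complex.ofReal_one, one_mul, Complex.ofReal_zero, zero_mul] at hint
    rw [← hint, alexander]
    congr 2
    ext s
    split_ifs with hs
    · rw [hs, dslope_same, h1]
    · rw [dslope_of_ne _ hs, slope_def_field, h0, sub_zero, sub_zero]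
  exact ((hg z hz).sub_const (g 0)).congr_of_eventuallyEq
    (Filter.eventuallyEq_of_mem (isOpen_ball.mem_nhds hz) heq)

lemma deriv_deriv_alexander {f : ℂ → ℂ} (hf : IsNormalized f) {z : ℂ} (hz : z ∈ unitDisk) :
    deriv (deriv (alexander f)) z = deriv (dslope f 0) z :=
  (Filter.eventuallyEq_of_mem (isOpen_ball.mem_nhds hz)
    fun _ hw => (hasDerivAt_alexander hf hw).deriv).deriv_eq

lemma dslope_zero_ne_zero {f : ℂ → ℂ} (hf : IsNormalized f)
    (hne : ∀ z ∈ unitDisk, z ≠ 0 → f z ≠ 0) {z : ℂ} (hz : z ∈ unitDisk) : dslope f 0 z ≠ 0 := by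
  rcases eq_or_ne z 0 with rfl | hz0
  · simp [hf.2.2]
  · rw [dslope_of_ne _ hz0, slope_def_field, hf.2.1, sub_zero, sub_zero]
    exact div_ne_zero (hne z hz hz0) hz0

lemma mul_logDeriv_dslope_zero {f : ℂ → ℂ} (hf : IsNormalized f)
    (hne : ∀ z ∈ unitDisk, z ≠ 0 → f z ≠ 0) {z : ℂ} (hz : z ∈ unitDisk) (hz0 : z ≠ 0) :
    z * (deriv (dslope f 0) z / dslope f 0 z) = sratio f z - 1 := by
  have hfun : f = fun w => w * dslope f 0 w := by
    ext w
    simpa [hf.2.1] using (sub_smul_dslope f 0 w).symm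
  have hh := dslope_zero_ne_zero hf hne hz
  have hd := ((differentiableOn_dslope_zero hf.1).differentiableAt
    (isOpen_ball.mem_nhds hz)).hasDerivAt
  have hf' : deriv f z = dslope f 0 z + z * deriv (dslope f 0) z := by
    have h := ((hasDerivAt_id z).mul hd).deriv
    simp only [id, one_mul] at h
    rw [← h]
    exact congrArg (deriv · z) hfun
  rw [sratio, if_neg hz0, hf', congrFun hfun z]
  field_simp
  ring

lemma norm_logDeriv_dslope_zero_le {lam : ℝ} (hlam : 0 < lam) {f : ℂ → ℂ}
    (hf : MemSstar (fun z => Complex.exp ((lam:ℂ) * z)) f) {z : ℂ} (hz : z ∈ unitDisk)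
    (hz0 : z ≠ 0) :
    ‖deriv (dslope f 0) z / dslope f 0 z‖ ≤ (Real.exp (lam * ‖z‖) - 1) / ‖z‖ := by
  obtain ⟨hn, hne, ω, hωa, hω0, hωm, hω⟩ := hf
  have hschwarz : ‖ω z‖ ≤ ‖z‖ := Complex.norm_le_norm_of_mapsTo_ball hωa.differentiableOn
    (hωm.mono_right ball_subset_closedBall) hω0 (mem_ball_zero_iff.1 hz)
  rw [le_div_iff₀' (norm_pos_iff.2 hz0), ← norm_mul, mul_logDeriv_dslope_zero hn hne hz hz0, hω hz]
  refine (norm_exp_sub_one_le_exp_norm_sub_one _).trans ?_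
  rw [norm_mul, Complex.norm_real, Real.norm_of_nonneg hlam.le]
  gcongr

/-- Pre-Schwarzian norm estimate for the Alexander transform of functions in S*_{λe}. -/
theorem preSchwarzian_bound_alexander_Sstar_lambda_e (lam : ℝ) (hlam₀ : 0 < lam)
    (hlam₁ : lam ≤ Real.pi / 2) (f : ℂ → ℂ)
    (hf : MemSstar (fun z => Complex.exp ((lam:ℂ) * z)) f)
    (α : ℝ) (hα : α ∈ Set.Ioo (0:ℝ) 1)
    (hroot : lam*α*Real.exp (lam*α)*(1 - α^2) - (1 + α^2)*(Real.exp (lam*α) - 1) = 0) :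
    ∀ z ∈ unitDisk, (1 - ‖z‖^2) *
        ‖deriv (deriv (alexander f)) z / deriv (alexander f) z‖ ≤
      (1 - α^2) * (Real.exp (lam*α) - 1) / α := by
  have hle : ∀ z ∈ unitDisk, z ≠ 0 → (1 - ‖z‖ ^ 2) * ‖deriv (dslope f 0) z / dslope f 0 z‖ ≤
      (1 - α ^ 2) * (Real.exp (lam * α) - 1) / α := by
    intro z hz hz0
    have hz1 : ‖z‖ < 1 := mem_ball_zero_iff.1 hz
    have hr0 := norm_pos_iff.2 hz0
    have hpos : 0 ≤ 1 - ‖z‖ ^ 2 := by nlinarith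
    refine (mul_le_mul_of_nonneg_left (norm_logDeriv_dslope_zero_le hlam₀ hf hz hz0) hpos).trans ?_
    rw [← mul_div_assoc]
    exact radial_bound hlam₀ (by linarith [Real.pi_le_four]) hα hroot ⟨hr0, hz1⟩
  intro z hz
  rw [deriv_deriv_alexander hf.1 hz, (hasDerivAt_alexander hf.1 hz).deriv]
  rcases ne_or_eq z 0 with hz0 | rfl
  · exact hle z hz hz0
  have hmem : unitDisk ∈ nhds (0:ℂ) := isOpen_ball.mem_nhds hz
  have han := (differentiableOn_dslope_zero hf.1.1).analyticAt hmem
  have hcont : ContinuousAt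
      (fun z : ℂ => (1 - ‖z‖ ^ 2) * ‖deriv (dslope f 0) z / dslope f 0 z‖) 0 :=
    ContinuousAt.mul (by fun_prop) (han.deriv.continuousAt.div han.continuousAt
      (dslope_zero_ne_zero hf.1 hf.2.1 hz)).norm
  refine le_of_tendsto (hcont.tendsto.mono_left (nhdsWithin_le_nhds (s := {0}ᶜ))) ?_
  filter_upwards [self_mem_nhdsWithin, nhdsWithin_le_nhds hmem] with w hw0 hw
  exact hle w hw hw0
end
end

section
/- Let 0 < λ ≤ π/2 and let f₃(z) = ∫₀^z exp(∫₀^u (e^{λt} − 1)/t dt) du. Then f₃ ∈ C_{λe} and its pre-Schwarzian norm satisfies ||P_{f₃}|| = (1 − α²)(e^{λα} − 1)/α, where α is the unique root in (0,1) of the equation λr e^{λr}(1 − r²) − (1 + r²)(e^{λr} − 1) = 0. In particular, the bound of the norm estimate for C_{λe} is sharp. -/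
open Metric Set

noncomputable section

/-- The integrand (e^{λt} − 1)/t, extended by its analytic value λ at t = 0. -/
def expIntegrand (lam : ℝ) (t : ℂ) : ℂ :=
  if t = 0 then (lam : ℂ) else (Complex.exp ((lam:ℂ) * t) - 1) / t

/-- The inner integral ∫₀^u (e^{λt} − 1)/t dt along the segment from 0 to u. -/
def innerExpIntegral (lam : ℝ) (u : ℂ) : ℂ :=
  u * ∫ s in (0:ℝ)..1, expIntegrand lam ((s:ℂ) * u)

/-- The extremal function f₃(z) = ∫₀^z exp(∫₀^u (e^{λt} − 1)/t dt) du, all integrals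
being taken along segments from 0. -/
def extremalCLambdaE (lam : ℝ) (z : ℂ) : ℂ :=
  z * ∫ s in (0:ℝ)..1, Complex.exp (innerExpIntegral lam ((s:ℂ) * z))

open Filter Topology in
/-- The complex derivative of the segment integral `z ∫₀¹ f(sz) ds` of an entire function. -/
lemma hasDerivAt_mul_segment_integral {f : ℂ → ℂ} (hf : Differentiable ℂ f) (z : ℂ) :
    HasDerivAt (fun w => w * ∫ s in (0:ℝ)..1, f ((s:ℂ) * w)) (f z) z := by
  obtain ⟨F, hF⟩ := hf.isExactOn_univ
  have key : (fun w => w * ∫ s in (0:ℝ)..1, f ((s:ℂ) * w)) = fun w => F w - F 0 := by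
    funext w
    have hd : ∀ s ∈ uIcc (0:ℝ) 1, HasDerivAt (fun s : ℝ => F ((s:ℂ) * w))
        (w * f ((s:ℂ) * w)) s := fun s _ => by
      have h := (hF ((s:ℂ) * w) (mem_univ _)).comp (s:ℂ) ((hasDerivAt_id (s:ℂ)).mul_const w)
      simpa [Function.comp_def, mul_comm] using h.comp_ofReal
    have hc : Continuous fun s : ℝ => w * f ((s:ℂ) * w) := by
      have := hf.continuous
      fun_prop
    have h := intervalIntegral.integral_eq_sub_of_hasDerivAt hd (hc.intervalIntegrable 0 1)
    rw [intervalIntegral.integral_const_mul] at h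
    simpa using h
  rw [key]
  exact (hF z (mem_univ z)).sub_const _

lemma expIntegrand_eq_dslope (lam : ℝ) :
    expIntegrand lam = dslope (fun t : ℂ => Complex.exp ((lam:ℂ) * t)) 0 := by
  have hd : HasDerivAt (fun t : ℂ => Complex.exp ((lam:ℂ) * t)) lam 0 := by
    simpa using ((hasDerivAt_id (0:ℂ)).const_mul (lam:ℂ)).cexp
  funext t
  by_cases ht : t = 0
  · simp [ht, expIntegrand, dslope_same, hd.deriv]
  · simp [ht, expIntegrand, dslope_of_ne, slope_def_field]

lemma differentiable_expIntegrand (lam : ℝ) : Differentiable ℂ (expIntegrand lam) := by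
  rw [expIntegrand_eq_dslope, ← differentiableOn_univ,
    Complex.differentiableOn_dslope Filter.univ_mem, differentiableOn_univ]
  fun_prop

lemma hasDerivAt_innerExpIntegral (lam : ℝ) (z : ℂ) :
    HasDerivAt (innerExpIntegral lam) (expIntegrand lam z) z :=
  hasDerivAt_mul_segment_integral (differentiable_expIntegrand lam) z

lemma hasDerivAt_extremalCLambdaE (lam : ℝ) (z : ℂ) :
    HasDerivAt (extremalCLambdaE lam) (Complex.exp (innerExpIntegral lam z)) z :=
  hasDerivAt_mul_segment_integral (f := fun z => Complex.exp (innerExpIntegral lam z))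
    (fun w => (hasDerivAt_innerExpIntegral lam w).differentiableAt.cexp) z

lemma deriv_extremalCLambdaE (lam : ℝ) :
    deriv (extremalCLambdaE lam) = fun z => Complex.exp (innerExpIntegral lam z) :=
  funext fun z => (hasDerivAt_extremalCLambdaE lam z).deriv

/-- The pre-Schwarzian derivative of the extremal function is `(e^{λz} - 1)/z`. -/
lemma preSchwarzian_extremalCLambdaE (lam : ℝ) (z : ℂ) :
    deriv (deriv (extremalCLambdaE lam)) z / deriv (extremalCLambdaE lam) z
      = expIntegrand lam z := by
  rw [deriv_extremalCLambdaE, (hasDerivAt_innerExpIntegral lam z).cexp.deriv,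
    mul_div_cancel_left₀ _ (Complex.exp_ne_zero _)]

lemma memC_extremalCLambdaE (lam : ℝ) :
    MemC (fun z => Complex.exp ((lam:ℂ) * z)) (extremalCLambdaE lam) := by
  refine ⟨⟨fun z _ => ?_, by simp [extremalCLambdaE], ?_⟩, fun z _ => ?_, id, ?_, rfl,
    mapsTo_id _, fun z _ => ?_⟩
  · exact Differentiable.analyticAt
      (fun w => (hasDerivAt_extremalCLambdaE lam w).differentiableAt) z
  · simp [deriv_extremalCLambdaE, innerExpIntegral]
  · simp [deriv_extremalCLambdaE]
  · exact analyticOnNhd_id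
  · simp only [mul_div_assoc, preSchwarzian_extremalCLambdaE, Function.comp_apply, id]
    by_cases hz : z = 0
    · simp [hz]
    · rw [expIntegrand, if_neg hz, mul_div_cancel₀ _ hz]
      ring

lemma norm_expIntegrand_le {lam : ℝ} (hlam : 0 ≤ lam) {z : ℂ} (hz : z ≠ 0) :
    ‖expIntegrand lam z‖ ≤ (Real.exp (lam * ‖z‖) - 1) / ‖z‖ := by
  rw [expIntegrand, if_neg hz, norm_div]
  gcongr
  simpa [abs_of_nonneg hlam] using Complex.norm_exp_sub_sum_le_exp_norm_sub_sum ((lam:ℂ) * z) 1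

/-- The numerator of the derivative of `(1 - r²)(e^{λr} - 1)/r` vanishes at `0`, and its own
derivative changes sign only once, so it is nonnegative before a positive zero and nonpositive
after it. -/
lemma sign_of_root {lam : ℝ} (hlam : 0 < lam) {α : ℝ} (hα : 0 < α)
    (hroot : lam*α*Real.exp (lam*α)*(1 - α^2) - (1 + α^2)*(Real.exp (lam*α) - 1) = 0) (r : ℝ) :
    (0 ≤ r → r ≤ α →
      0 ≤ lam*r*Real.exp (lam*r)*(1 - r^2) - (1 + r^2)*(Real.exp (lam*r) - 1)) ∧
    (α ≤ r → lam*r*Real.exp (lam*r)*(1 - r^2) - (1 + r^2)*(Real.exp (lam*r) - 1) ≤ 0) := by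
  set Φ : ℝ → ℝ := fun r =>
    lam*r*Real.exp (lam*r)*(1 - r^2) - (1 + r^2)*(Real.exp (lam*r) - 1) with hΦ
  set G : ℝ → ℝ := fun r => lam^2*(1 - r^2) - 4*lam*r - 2*(1 - Real.exp (-(lam*r))) with hG
  have hderiv (r : ℝ) : HasDerivAt Φ (r * Real.exp (lam*r) * G r) r := by
    have hl : HasDerivAt (fun r : ℝ => lam * r) lam r := by
      simpa using (hasDerivAt_id r).const_mul lam
    have hsq : HasDerivAt (fun r : ℝ => r^2) (2*r) r := by simpa using hasDerivAt_pow 2 r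
    have h := ((hl.mul hl.exp).mul (hsq.const_sub 1)).sub
      ((hsq.const_add 1).mul (hl.exp.sub_const 1))
    refine h.congr_deriv ?_
    have he : Real.exp (lam*r) * Real.exp (-(lam*r)) = 1 := by
      rw [← Real.exp_add]; simp
    simp only [hG, Pi.mul_apply]
    linear_combination -2 * r * he
  have hcont : Continuous Φ := continuous_iff_continuousAt.2 fun r => (hderiv r).continuousAt
  have hanti : AntitoneOn G (Ici 0) := by
    intro a ha b hb hab
    have ha' : 0 ≤ a := ha
    have h1 : a^2 ≤ b^2 := by gcongr
    have h2 : Real.exp (-(lam*b)) ≤ Real.exp (-(lam*a)) := by gcongr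
    have h3 : lam^2 * a^2 ≤ lam^2 * b^2 := by gcongr
    have h4 : lam * a ≤ lam * b := by gcongr
    simp only [hG]
    linarith
  have h0 : Φ 0 = 0 := by simp [hΦ]
  have hα0 : Φ α = 0 := hroot
  obtain ⟨c, ⟨hc0, hcα⟩, hc⟩ := exists_hasDerivAt_eq_zero hα hcont.continuousOn
    (h0.trans hα0.symm) fun x _ => hderiv x
  have hGc : G c = 0 := by simpa [hc0.ne', Real.exp_ne_zero] using hc
  have hmono : MonotoneOn Φ (Icc 0 c) := by
    refine monotoneOn_of_hasDerivWithinAt_nonneg (convex_Icc 0 c) hcont.continuousOn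
      (fun x _ => (hderiv x).hasDerivWithinAt) fun x hx => ?_
    rw [interior_Icc] at hx
    have : 0 ≤ G x := hGc ▸ hanti hx.1.le hc0.le hx.2.le
    have := hx.1.le
    positivity
  have hanti' : AntitoneOn Φ (Ici c) := by
    refine antitoneOn_of_hasDerivWithinAt_nonpos (convex_Ici c) hcont.continuousOn
      (fun x _ => (hderiv x).hasDerivWithinAt) fun x hx => ?_
    rw [interior_Ici] at hx
    have hx0 : 0 ≤ x := hc0.le.trans (le_of_lt hx)
    have : G x ≤ 0 := hGc ▸ hanti hc0.le hx0 (le_of_lt hx)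
    exact mul_nonpos_of_nonneg_of_nonpos (by positivity) this
  refine ⟨fun hr hrα => ?_, fun hr => hα0 ▸ hanti' hcα.le (hcα.le.trans hr) hr⟩
  rcases le_total r c with hrc | hrc
  · exact h0 ▸ hmono ⟨le_rfl, hc0.le⟩ ⟨hr, hrc⟩ hr
  · exact hα0 ▸ hanti' hrc hcα.le hrα

lemma radial_le_of_root {lam : ℝ} (hlam : 0 < lam) {α : ℝ} (hα : 0 < α)
    (hroot : lam*α*Real.exp (lam*α)*(1 - α^2) - (1 + α^2)*(Real.exp (lam*α) - 1) = 0)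
    {r : ℝ} (hr : 0 < r) :
    (1 - r^2) * (Real.exp (lam*r) - 1) / r ≤ (1 - α^2) * (Real.exp (lam*α) - 1) / α := by
  set h : ℝ → ℝ := fun r => (1 - r^2) * (Real.exp (lam*r) - 1) / r with hh
  have hderiv (x : ℝ) (hx : 0 < x) : HasDerivAt h
      ((lam*x*Real.exp (lam*x)*(1 - x^2) - (1 + x^2)*(Real.exp (lam*x) - 1)) / x^2) x := by
    have hl : HasDerivAt (fun r : ℝ => lam * r) lam x := by
      simpa using (hasDerivAt_id x).const_mul lam
    have hsq : HasDerivAt (fun r : ℝ => r^2) (2*x) x := by simpa using hasDerivAt_pow 2 x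
    have hn := (hsq.const_sub 1).mul (hl.exp.sub_const 1)
    refine (hn.div (hasDerivAt_id x) hx.ne').congr_deriv ?_
    simp only [id, Pi.mul_apply]
    ring
  rcases le_total r α with hrα | hrα
  · have hpos : ∀ x ∈ Icc r α, 0 < x := fun x hx => hr.trans_le hx.1
    refine monotoneOn_of_hasDerivWithinAt_nonneg (convex_Icc r α)
      (fun x hx => (hderiv x (hpos x hx)).continuousAt.continuousWithinAt)
      (fun x hx => (hderiv x (hpos x (interior_subset hx))).hasDerivWithinAt)
      (fun x hx => ?_) ⟨le_rfl, hrα⟩ ⟨hrα, le_rfl⟩ hrα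
    have hx := interior_subset hx
    exact div_nonneg ((sign_of_root hlam hα hroot x).1 (hpos x hx).le hx.2) (by positivity)
  · have hpos : ∀ x ∈ Icc α r, 0 < x := fun x hx => hα.trans_le hx.1
    refine antitoneOn_of_hasDerivWithinAt_nonpos (convex_Icc α r)
      (fun x hx => (hderiv x (hpos x hx)).continuousAt.continuousWithinAt)
      (fun x hx => (hderiv x (hpos x (interior_subset hx))).hasDerivWithinAt)
      (fun x hx => ?_) ⟨le_rfl, hrα⟩ ⟨hrα, le_rfl⟩ hrα
    exact div_nonpos_of_nonpos_of_nonneg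
      ((sign_of_root hlam hα hroot x).2 (interior_subset hx).1) (by positivity)

open Filter Topology in
/-- The value at the origin is dominated as well, as a limit of the radial values. -/
lemma le_of_root {lam : ℝ} (hlam : 0 < lam) {α : ℝ} (hα : 0 < α)
    (hroot : lam*α*Real.exp (lam*α)*(1 - α^2) - (1 + α^2)*(Real.exp (lam*α) - 1) = 0) :
    lam ≤ (1 - α^2) * (Real.exp (lam*α) - 1) / α := by
  have ht : Tendsto (fun r : ℝ => (1 - r^2) * lam) (𝓝[>] 0) (𝓝 lam) := by
    have hc : Continuous fun r : ℝ => (1 - r^2) * lam := by fun_prop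
    simpa using (hc.tendsto 0).mono_left nhdsWithin_le_nhds
  refine le_of_tendsto ht ?_
  filter_upwards [Ioo_mem_nhdsGT (zero_lt_one (α := ℝ))] with r hr
  refine le_trans ?_ (radial_le_of_root hlam hα hroot hr.1)
  rw [mul_div_assoc]
  refine mul_le_mul_of_nonneg_left ?_ (by nlinarith [hr.1, hr.2])
  rw [le_div_iff₀ hr.1]
  linarith [Real.add_one_le_exp (lam * r)]

/-- Sharpness of the pre-Schwarzian norm estimate for C_{λe}: the extremal function f₃
belongs to C_{λe} and its pre-Schwarzian norm equals the bound. -/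
theorem preSchwarzian_sharp_C_lambda_e (lam : ℝ) (hlam₀ : 0 < lam)
    (hlam₁ : lam ≤ Real.pi / 2)
    (α : ℝ) (hα : α ∈ Set.Ioo (0:ℝ) 1)
    (hroot : lam*α*Real.exp (lam*α)*(1 - α^2) - (1 + α^2)*(Real.exp (lam*α) - 1) = 0) :
    MemC (fun z => Complex.exp ((lam:ℂ) * z)) (extremalCLambdaE lam) ∧
      IsLUB (pSVals (extremalCLambdaE lam))
        ((1 - α^2) * (Real.exp (lam*α) - 1) / α) := by
  refine ⟨memC_extremalCLambdaE lam, IsGreatest.isLUB ⟨⟨(α : ℂ), ?_, ?_⟩, ?_⟩⟩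
  · simpa [unitDisk, abs_of_pos hα.1] using hα.2
  · have h1 : 0 ≤ Real.exp (lam * α) - 1 :=
      sub_nonneg.2 (Real.one_le_exp (mul_pos hlam₀ hα.1).le)
    rw [preSchwarzian_extremalCLambdaE, expIntegrand,
      if_neg (Complex.ofReal_ne_zero.2 hα.1.ne'), norm_div, Complex.norm_of_nonneg hα.1.le,
      show Complex.exp ((lam:ℂ) * α) - 1 = ((Real.exp (lam * α) - 1 : ℝ) : ℂ) by push_cast; rfl,
      Complex.norm_of_nonneg h1, mul_div_assoc]
  · rintro _ ⟨z, hz, rfl⟩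
    rw [preSchwarzian_extremalCLambdaE]
    by_cases hz0 : z = 0
    · simpa [hz0, expIntegrand, abs_of_pos hlam₀] using le_of_root hlam₀ hα.1 hroot
    · have hz1 : ‖z‖ < 1 := by simpa [unitDisk] using hz
      refine le_trans ?_ (radial_le_of_root hlam₀ hα.1 hroot (norm_pos_iff.2 hz0))
      rw [mul_div_assoc]
      exact mul_le_mul_of_nonneg_left (norm_expIntegrand_le hlam₀.le hz0)
        (by nlinarith [norm_nonneg z])
end
end

section
/- Let 0 < c ≤ 1. Then the function r ↦ 2(1 + r²)(1 − √(1 − cr)) − c(r + 3r³) has exactly one root in the open interval (0,1). -/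
/-- On `(0,1)`, the equation involving the square root is equivalent to a polynomial one. -/
lemma sqrt_equation_iff_polynomial {c r : ℝ} (hc₀ : 0 < c) (hc₁ : c ≤ 1)
    (hr₀ : 0 < r) (hr₁ : r < 1) :
    2*(1 + r^2)*(1 - Real.sqrt (1 - c*r)) - c*(r + 3*r^3) = 0 ↔
      c*(1 + 3*r^2)^2 - 8*r*(1 + r^2) = 0 := by
  have hcr : 0 ≤ 1 - c*r := by nlinarith
  have hs₀ := Real.sqrt_nonneg (1 - c*r)
  have hs := Real.sq_sqrt hcr
  set s := Real.sqrt (1 - c*r)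
  have hcr_pos : 0 < c*r := mul_pos hc₀ hr₀
  have hs₁ : s < 1 := by nlinarith
  have hcr_eq : c*r = (1 - s)*(1 + s) := by linarith
  have hfactor : 2*(1 + r^2)*(1 - s) - c*(r + 3*r^3) =
      (1 - s)*((1 - r^2) - s*(1 + 3*r^2)) := by
    linear_combination (-(1 + 3*r^2))*hcr_eq
  have hpoly : r*(c*(1 + 3*r^2)^2 - 8*r*(1 + r^2)) =
      ((1 - r^2) - s*(1 + 3*r^2))*((1 - r^2) + s*(1 + 3*r^2)) := by
    linear_combination (1 + 3*r^2)^2*hcr_eq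
  have hsum : 0 < (1 - r^2) + s*(1 + 3*r^2) := by
    have : 0 ≤ s*(1 + 3*r^2) := by positivity
    nlinarith
  rw [hfactor, mul_eq_zero, or_iff_right (by linarith)]
  constructor
  · intro h
    rw [h, zero_mul] at hpoly
    exact (mul_eq_zero.mp hpoly).resolve_left hr₀.ne'
  · intro h
    rw [h, mul_zero] at hpoly
    exact (mul_eq_zero.mp hpoly.symm).resolve_right hsum.ne'

lemma polynomial_root_lt {c r : ℝ} (hc₁ : c ≤ 1) (hr₁ : r < 1)
    (h : c*(1 + 3*r^2)^2 - 8*r*(1 + r^2) = 0) : r < 1/7 := by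
  have hprod : 0 ≤ (1 - r)*(1 - 7*r - r^2 - 9*r^3) := by
    nlinarith [mul_nonneg (sub_nonneg.mpr hc₁) (sq_nonneg (1 + 3*r^2))]
  have hcubic : 0 ≤ 1 - 7*r - r^2 - 9*r^3 :=
    nonneg_of_mul_nonneg_right hprod (sub_pos.mpr hr₁)
  by_contra! hr
  have : 0 < r^3 := by positivity
  nlinarith [sq_nonneg r]

lemma polynomial_root_unique {c a b : ℝ} (hc₁ : c ≤ 1)
    (ha₀ : 0 < a) (ha : a < 1/7) (hb₀ : 0 < b) (hb : b < 1/7)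
    (hra : c*(1 + 3*a^2)^2 - 8*a*(1 + a^2) = 0)
    (hrb : c*(1 + 3*b^2)^2 - 8*b*(1 + b^2) = 0) : a = b := by
  have hprod : (a - b)*
      (c*((a + b)*(9*(a^2 + b^2) + 6)) - 8*(a^2 + a*b + b^2) - 8) = 0 := by
    linear_combination hra - hrb
  have hsq : a^2 + b^2 < 1 := by nlinarith
  have hle : (a + b)*(9*(a^2 + b^2) + 6) ≤ 2/7*15 := by
    apply mul_le_mul <;> first | positivity | linarith
  have hcle : c*((a + b)*(9*(a^2 + b^2) + 6)) ≤ (a + b)*(9*(a^2 + b^2) + 6) :=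
    mul_le_of_le_one_left (by positivity) hc₁
  have hneg : c*((a + b)*(9*(a^2 + b^2) + 6)) - 8*(a^2 + a*b + b^2) - 8 < 0 := by
    have : 0 < a^2 + a*b + b^2 := by positivity
    linarith
  exact sub_eq_zero.mp ((mul_eq_zero.mp hprod).resolve_right hneg.ne)

/-- For 0 < c ≤ 1, the function r ↦ 2(1 + r²)(1 − √(1 − cr)) − c(r + 3r³)
has exactly one root in (0,1). -/
theorem unique_root_C_qc (c : ℝ) (hc₀ : 0 < c) (hc₁ : c ≤ 1) :
    ∃! r : ℝ, r ∈ Set.Ioo (0:ℝ) 1 ∧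
      2*(1 + r^2)*(1 - Real.sqrt (1 - c*r)) - c*(r + 3*r^3) = 0 := by
  have hivt := intermediate_value_Ioo' (a := (0:ℝ)) (b := 1/7) (by norm_num)
    (f := fun r => c*(1 + 3*r^2)^2 - 8*r*(1 + r^2)) (by fun_prop)
  obtain ⟨r, ⟨hr₀, hr⟩, hroot⟩ := hivt (show (0:ℝ) ∈ Set.Ioo _ _ by
    constructor <;> norm_num <;> linarith)
  have hr₁ : r < 1 := by linarith
  refine ⟨r, ⟨⟨hr₀, hr₁⟩, (sqrt_equation_iff_polynomial hc₀ hc₁ hr₀ hr₁).mpr hroot⟩, ?_⟩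
  rintro t ⟨⟨ht₀, ht₁⟩, ht⟩
  have ht' := (sqrt_equation_iff_polynomial hc₀ hc₁ ht₀ ht₁).mp ht
  exact polynomial_root_unique hc₁ ht₀ (polynomial_root_lt hc₁ ht₁ ht') hr₀ hr ht' hroot
end
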